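/- For all integers N ≥ 0 and n ≥ 1, one has −exp(−(π/2)√(2n/3)) < R_{2N}(n) < (6√2/π^{3/2}) · sinh(π/6) · (√(2N+1)/(√(24n))^{2N}) · √(1 + 1/(4N+1)) + exp(−(π/2)√(2n/3)). -/

import Mathlib

open Real Finset Filter Topology

noncomputable def c (m : ℕ) : ℝ :=
  ((-1 : ℝ) ^ m / (4 * Real.sqrt 6) ^ m) *
    ∑ k ∈ Finset.range ((m + 1) / 2 + 1),
      ((m + 1).choose k : ℝ) * ((m + 1 - k : ℕ) : ℝ) / ((m + 1 - 2 * k).factorial : ℝ) *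
        (π / 6) ^ ((m : ℤ) - 2 * k)

/-- The number of partitions of `n`, as a real number. -/
noncomputable def p (n : ℕ) : ℝ := (Fintype.card (Nat.Partition n) : ℝ)

/-- The remainder after `N` terms of the asymptotic expansion. -/
noncomputable def R (N n : ℕ) : ℝ :=
  4 * Real.sqrt 3 * (n : ℝ) * Real.exp (-(π * Real.sqrt (2 * n / 3))) * p n -
    ∑ m ∈ Finset.range N, c m / (n : ℝ) ^ ((m : ℝ) / 2)

/-- The Euler product `∏ (1 - q ^ (n + 1))`. -/
noncomputable def eulerProd (q : ℂ) : ℂ := ∏' n : ℕ, (1 - q ^ (n + 1))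

/-- The number of partitions of `n` into parts of size at most `K`, read off from the
generating function. -/
noncomputable def boundedPart (K n : ℕ) : ℝ :=
  PowerSeries.coeff n (∏ i ∈ range K, (1 - PowerSeries.X ^ (i + 1) : PowerSeries ℝ)⁻¹)

lemma one_sub_X_pow_mul_inv (i : ℕ) :
    (1 - PowerSeries.X ^ (i + 1) : PowerSeries ℝ) * (1 - PowerSeries.X ^ (i + 1))⁻¹ = 1 :=
  PowerSeries.mul_inv_cancel _ (by simp)

lemma boundedPart_zero (n : ℕ) : boundedPart 0 n = if n = 0 then 1 else 0 := by
  simp [boundedPart, PowerSeries.coeff_one]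

lemma boundedPart_succ (K n : ℕ) :
    boundedPart (K + 1) n =
      boundedPart K n + if K + 1 ≤ n then boundedPart (K + 1) (n - (K + 1)) else 0 := by
  have h : (∏ i ∈ range (K + 1), (1 - PowerSeries.X ^ (i + 1) : PowerSeries ℝ)⁻¹) =
      (∏ i ∈ range K, (1 - PowerSeries.X ^ (i + 1) : PowerSeries ℝ)⁻¹) + PowerSeries.X ^ (K + 1) *
        ∏ i ∈ range (K + 1), (1 - PowerSeries.X ^ (i + 1) : PowerSeries ℝ)⁻¹ := by
    rw [prod_range_succ]
    linear_combination (∏ i ∈ range K, (1 - PowerSeries.X ^ (i + 1) : PowerSeries ℝ)⁻¹) *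
      one_sub_X_pow_mul_inv K
  unfold boundedPart
  conv_lhs => rw [h]
  rw [map_add, PowerSeries.coeff_X_pow_mul']

lemma boundedPart_nonneg (K n : ℕ) : 0 ≤ boundedPart K n := by
  induction K generalizing n with
  | zero => rw [boundedPart_zero]; positivity
  | succ K ih =>
    induction n using Nat.strong_induction_on with
    | _ n ihn =>
      rw [boundedPart_succ]
      have := ih n
      split_ifs with h
      · have := ihn (n - (K + 1)) (by omega)
        linarith
      · linarith

lemma boundedPart_mono (n : ℕ) : Monotone fun K ↦ boundedPart K n := by
  refine monotone_nat_of_le_succ fun K ↦ ?_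
  rw [boundedPart_succ]
  split_ifs
  · linarith [boundedPart_nonneg (K + 1) (n - (K + 1))]
  · linarith

open PowerSeries.WithPiTopology in
lemma tendsto_boundedPart (n : ℕ) : Tendsto (fun K ↦ boundedPart K n) atTop (𝓝 (p n)) := by
  have h := (Nat.Partition.hasProd_powerSeriesMk_card_restricted ℝ (fun _ ↦ True)).tendsto_prod_nat
  have h2 := ((PowerSeries.WithPiTopology.continuous_coeff ℝ n).tendsto _).comp h
  have h3 : p n = PowerSeries.coeff n
      (PowerSeries.mk fun n ↦ ((Nat.Partition.restricted n (fun _ ↦ True)).card : ℝ)) := by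
    simp [p, Nat.Partition.restricted]
  rw [h3]
  refine h2.congr fun K ↦ ?_
  simp only [Function.comp, boundedPart, if_true]
  congr 1
  refine prod_congr rfl fun i _ ↦ ?_
  rw [PowerSeries.eq_inv_iff_mul_eq_one (by simp)]
  simp_rw [pow_mul]
  exact PowerSeries.WithPiTopology.tsum_pow_mul_one_sub_of_constantCoeff_eq_zero (by simp)

lemma boundedPart_le (K n : ℕ) : boundedPart K n ≤ p n :=
  (boundedPart_mono n).ge_of_tendsto (tendsto_boundedPart n) K

lemma sum_boundedPart_succ_le (K N : ℕ) {r : ℝ} (hr : 0 ≤ r) :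
    ∑ n ∈ range N, boundedPart (K + 1) n * r ^ n ≤
      ∑ n ∈ range N, boundedPart K n * r ^ n +
        r ^ (K + 1) * ∑ n ∈ range N, boundedPart (K + 1) n * r ^ n := by
  have h : ∑ n ∈ range N, (if K + 1 ≤ n then boundedPart (K + 1) (n - (K + 1)) else 0) * r ^ n ≤
      r ^ (K + 1) * ∑ n ∈ range N, boundedPart (K + 1) n * r ^ n := by
    rw [mul_sum]
    simp_rw [ite_mul, zero_mul]
    rw [← sum_filter]
    refine (sum_le_sum_of_subset_of_nonneg (t := (range N).image (· + (K + 1))) ?_ ?_).trans ?_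
    · intro n hn
      simp only [mem_filter, mem_range, mem_image] at hn ⊢
      exact ⟨n - (K + 1), by omega, by omega⟩
    · intros
      exact mul_nonneg (boundedPart_nonneg _ _) (by positivity)
    · rw [sum_image (fun a _ b _ h ↦ by simpa using h)]
      refine le_of_eq (sum_congr rfl fun n _ ↦ ?_)
      rw [Nat.add_sub_cancel]
      ring
  calc _ = ∑ n ∈ range N, (boundedPart K n * r ^ n +
        (if K + 1 ≤ n then boundedPart (K + 1) (n - (K + 1)) else 0) * r ^ n) :=
        sum_congr rfl fun n _ ↦ by rw [boundedPart_succ, add_mul]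
    _ ≤ _ := by rw [sum_add_distrib]; linarith

lemma sum_boundedPart_mul_prod_le (K N : ℕ) {r : ℝ} (hr : 0 ≤ r) (hr1 : r < 1) :
    (∑ n ∈ range N, boundedPart K n * r ^ n) * ∏ i ∈ range K, (1 - r ^ (i + 1)) ≤ 1 := by
  induction K with
  | zero =>
    simp only [boundedPart_zero, range_zero, prod_empty, mul_one, ite_mul, one_mul, zero_mul]
    rw [sum_ite_eq']
    split_ifs <;> simp
  | succ K ih =>
    refine le_trans ?_ ih
    rw [prod_range_succ]
    have h := sum_boundedPart_succ_le K N hr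
    have h0 : 0 ≤ ∏ i ∈ range K, (1 - r ^ (i + 1)) :=
      prod_nonneg fun i _ ↦ sub_nonneg.2 (pow_le_one₀ hr hr1.le)
    nlinarith

lemma summable_p_mul_pow {r : ℝ} (hr : 0 ≤ r) (hr1 : r < 1) :
    Summable fun n ↦ p n * r ^ n := by
  have hm : Multipliable fun n : ℕ ↦ 1 - r ^ (n + 1) := by
    have := Real.multipliable_one_add_of_summable (f := fun n : ℕ ↦ -r ^ (n + 1)) ?_
    · simpa [sub_eq_add_neg] using this
    · exact ((summable_nat_add_iff 1).2 (summable_geometric_of_lt_one hr hr1)).neg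
  have hpos : 0 < ∏' n : ℕ, (1 - r ^ (n + 1)) := by
    have h1 : ∏' n : ℕ, (1 - r ^ (n + 1)) ≠ 0 := by
      have := tprod_one_add_ne_zero_of_summable (f := fun n : ℕ ↦ -r ^ (n + 1)) ?_ ?_
      · simpa [sub_eq_add_neg] using this
      · intro i
        have : r ^ (i + 1) < 1 := pow_lt_one₀ hr hr1 (by simp)
        linarith
      · simpa [abs_of_nonneg hr] using
          (summable_nat_add_iff 1).2 (summable_geometric_of_lt_one hr hr1)
    refine lt_of_le_of_ne ?_ h1.symm
    refine ge_of_tendsto' hm.hasProd.tendsto_prod_nat fun K ↦ prod_nonneg fun i _ ↦ ?_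
    exact sub_nonneg.2 (pow_le_one₀ hr hr1.le)
  refine summable_of_sum_range_le (c := (∏' n : ℕ, (1 - r ^ (n + 1)))⁻¹)
    (fun n ↦ mul_nonneg (by unfold p; positivity) (by positivity)) fun N ↦ ?_
  rw [← one_div, le_div_iff₀ hpos]
  refine le_of_tendsto' (Tendsto.mul (tendsto_finsetSum _ fun n _ ↦
    (tendsto_boundedPart n).mul_const (r ^ n)) hm.hasProd.tendsto_prod_nat) fun K ↦ ?_
  exact sum_boundedPart_mul_prod_le K N hr hr1

lemma hasSum_p_mul_pow {q : ℂ} (hq : ‖q‖ < 1) :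
    HasSum (fun n ↦ (p n : ℂ) * q ^ n) (eulerProd q)⁻¹ := by
  have hsp := summable_p_mul_pow (norm_nonneg q) hq
  have hs (K : ℕ) : Summable fun n ↦ (boundedPart K n : ℂ) * q ^ n := by
    refine Summable.of_norm_bounded hsp fun n ↦ ?_
    rw [norm_mul, norm_pow, Complex.norm_of_nonneg (boundedPart_nonneg K n)]
    gcongr
    exact boundedPart_le K n
  have hs' : Summable fun n ↦ (p n : ℂ) * q ^ n := by
    refine Summable.of_norm_bounded hsp fun n ↦ ?_
    rw [norm_mul, norm_pow, Complex.norm_of_nonneg (by unfold p; positivity)]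
  have hrec (K : ℕ) : ∑' n, (boundedPart (K + 1) n : ℂ) * q ^ n =
      ∑' n, (boundedPart K n : ℂ) * q ^ n +
        q ^ (K + 1) * ∑' n, (boundedPart (K + 1) n : ℂ) * q ^ n := by
    have h1 : HasSum (fun n ↦ if K + 1 ≤ n then
        (boundedPart (K + 1) (n - (K + 1)) : ℂ) * q ^ n else 0)
        (q ^ (K + 1) * ∑' n, (boundedPart (K + 1) n : ℂ) * q ^ n) := by
      rw [← (add_left_injective (K + 1)).hasSum_iff]
      · refine ((hs (K + 1)).hasSum.mul_left (q ^ (K + 1))).congr_fun fun n ↦ ?_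
        simp only [Function.comp, if_pos (Nat.le_add_left (K + 1) n), Nat.add_sub_cancel, pow_add]
        ring
      · intro n hn
        rw [if_neg]
        intro h
        exact hn ⟨n - (K + 1), by simp; omega⟩
    refine HasSum.tsum_eq ?_
    convert (hs K).hasSum.add h1 using 2 with n
    rw [boundedPart_succ]
    split_ifs <;> push_cast <;> ring
  have hK (K : ℕ) :
      (∑' n, (boundedPart K n : ℂ) * q ^ n) * ∏ i ∈ range K, (1 - q ^ (i + 1)) = 1 := by
    induction K with
    | zero =>
      rw [tsum_eq_single 0 (by intro n hn; simp [boundedPart_zero, hn])]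
      simp [boundedPart_zero]
    | succ K ih =>
      rw [prod_range_succ]
      linear_combination ih + (∏ i ∈ range K, (1 - q ^ (i + 1))) * hrec K
  have hlim : Tendsto (fun K ↦ ∑' n, (boundedPart K n : ℂ) * q ^ n) atTop
      (𝓝 (∑' n, (p n : ℂ) * q ^ n)) := by
    refine tendsto_tsum_of_dominated_convergence hsp (fun n ↦ ?_) (.of_forall fun K n ↦ ?_)
    · exact ((Complex.continuous_ofReal.tendsto _).comp (tendsto_boundedPart n)).mul_const _
    · rw [norm_mul, norm_pow, Complex.norm_of_nonneg (boundedPart_nonneg K n)]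
      gcongr
      exact boundedPart_le K n
  have h1 : (∑' n, (p n : ℂ) * q ^ n) * eulerProd q = 1 :=
    tendsto_nhds_unique ((hlim.mul
      (ModularForm.multipliable_one_sub_pow hq).hasProd.tendsto_prod_nat).congr hK)
      tendsto_const_nhds
  rw [← eq_inv_of_mul_eq_one_left h1]
  exact hs'.hasSum

lemma eulerProd_ne_zero {q : ℂ} (hq : ‖q‖ < 1) : eulerProd q ≠ 0 := by
  have h := tprod_one_add_ne_zero_of_summable (f := fun n : ℕ ↦ -q ^ (n + 1)) ?_ ?_
  · simpa [sub_eq_add_neg, eulerProd] using h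
  · intro i h
    have h1 : q ^ (i + 1) = 1 := by linear_combination -h
    have h2 : ‖q‖ ^ (i + 1) < 1 := pow_lt_one₀ (norm_nonneg q) hq (by simp)
    rw [← norm_pow, h1, norm_one] at h2
    exact lt_irrefl _ h2
  · simpa using (summable_nat_add_iff 1).2 (summable_geometric_of_lt_one (norm_nonneg q) hq)

/-- The generating function of the partition numbers, as a function on the unit disc. -/
noncomputable def partGF (q : ℂ) : ℂ := (eulerProd q)⁻¹

lemma partGF_ne_zero {q : ℂ} (hq : ‖q‖ < 1) : partGF q ≠ 0 :=
  inv_ne_zero (eulerProd_ne_zero hq)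

lemma hasSum_partGF {q : ℂ} (hq : ‖q‖ < 1) :
    HasSum (fun n ↦ (p n : ℂ) * q ^ n) (partGF q) := hasSum_p_mul_pow hq

lemma norm_exp_neg_lt_one {z : ℂ} (hz : 0 < z.re) {a : ℝ} (ha : 0 < a) :
    ‖Complex.exp (-(a * z))‖ < 1 := by
  rw [Complex.norm_exp, Real.exp_lt_one_iff]
  simp only [Complex.neg_re, Complex.re_ofReal_mul]
  linarith [mul_pos ha hz]

lemma sqrt_mul_of_arg {x y : ℂ} (hx : x ≠ 0) (hy : y ≠ 0)
    (h : x.arg + y.arg ∈ Set.Ioc (-π) π) :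
    Complex.sqrt (x * y) = Complex.sqrt x * Complex.sqrt y := by
  simp only [Complex.sqrt]
  rw [Complex.cpow_def_of_ne_zero (mul_ne_zero hx hy), Complex.cpow_def_of_ne_zero hx,
    Complex.cpow_def_of_ne_zero hy, Complex.log_mul hx hy h, add_mul, Complex.exp_add]

lemma sqrt_ne_zero' {x : ℂ} (hx : x ≠ 0) : Complex.sqrt x ≠ 0 := by
  simp [Complex.sqrt, Complex.cpow_eq_zero_iff, hx]

lemma sqrt_sq' (x : ℂ) : Complex.sqrt x ^ 2 = x := by
  rw [Complex.sqrt, ← Complex.cpow_nat_mul]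
  norm_num

lemma ne_zero_of_re_pos {z : ℂ} (hz : 0 < z.re) : z ≠ 0 := by
  rintro rfl
  simp at hz

lemma inv_re_pos {z : ℂ} (hz : 0 < z.re) : 0 < (z⁻¹).re := by
  rw [Complex.inv_re]
  exact div_pos hz (Complex.normSq_pos.2 (ne_zero_of_re_pos hz))

lemma sqrt_I_mul {z : ℂ} (hz : 0 < z.re) :
    Complex.sqrt (Complex.I * z) = Complex.sqrt Complex.I * Complex.sqrt z := by
  refine sqrt_mul_of_arg Complex.I_ne_zero (ne_zero_of_re_pos hz) ?_
  have := abs_lt.1 (Complex.abs_arg_lt_pi_div_two_iff.2 (Or.inl hz))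
  rw [Complex.arg_I]
  constructor <;> linarith [this.1, this.2, Real.pi_pos]

lemma sqrt_ofReal_mul {z : ℂ} (hz : 0 < z.re) {a : ℝ} (ha : 0 < a) :
    Complex.sqrt (a * z) = Complex.sqrt a * Complex.sqrt z := by
  refine sqrt_mul_of_arg (by exact_mod_cast ha.ne') (ne_zero_of_re_pos hz) ?_
  have := abs_lt.1 (Complex.abs_arg_lt_pi_div_two_iff.2 (Or.inl hz))
  rw [Complex.arg_ofReal_of_nonneg ha.le]
  constructor <;> linarith [this.1, this.2, Real.pi_pos]

lemma eta_I_mul (z : ℂ) : ModularForm.eta (Complex.I * z) =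
    Complex.exp (-(π / 12 * z)) * eulerProd (Complex.exp (-((2 * π : ℝ) * z))) := by
  unfold ModularForm.eta eulerProd Function.Periodic.qParam
  congr 2
  · push_cast
    linear_combination (2 * π * z / 24) * Complex.I_sq
  · ext n
    rw [ModularForm.eta_q_eq_pow]
    congr 3
    push_cast
    linear_combination (2 * π * z) * Complex.I_sq

/-- The transformation of the partition generating function under `z ↦ 1 / z`. -/
lemma partGF_exp_neg {z : ℂ} (hz : 0 < z.re) :
    partGF (Complex.exp (-((2 * π : ℝ) * z))) = Complex.sqrt z *
      Complex.exp (π / 12 * (z⁻¹ - z)) * partGF (Complex.exp (-((2 * π : ℝ) * z⁻¹))) := by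
  have h := ModularForm.eta_comp_eq_csqrt_I_inv (x := Complex.I * z) (by simpa using hz)
  have hz0 := ne_zero_of_re_pos hz
  simp only [Function.comp, Pi.smul_apply, Pi.mul_apply, smul_eq_mul] at h
  rw [show -1 / (Complex.I * z) = Complex.I * z⁻¹ by
    field_simp; rw [Complex.I_sq], eta_I_mul, eta_I_mul, sqrt_I_mul hz] at h
  have hI := sqrt_ne_zero' Complex.I_ne_zero
  have hs := sqrt_ne_zero' hz0
  have h1 := eulerProd_ne_zero (norm_exp_neg_lt_one hz Real.two_pi_pos)
  have h2 := eulerProd_ne_zero (norm_exp_neg_lt_one (inv_re_pos hz) Real.two_pi_pos)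
  unfold partGF
  rw [mul_sub, Complex.exp_sub]
  rw [Complex.exp_neg, Complex.exp_neg (π / 12 * z)] at h
  have e1 := Complex.exp_ne_zero (π / 12 * z⁻¹)
  have e2 := Complex.exp_ne_zero (π / 12 * z)
  generalize eulerProd (Complex.exp (-((2 * π : ℝ) * z))) = E₁ at *
  generalize eulerProd (Complex.exp (-((2 * π : ℝ) * z⁻¹))) = E₂ at *
  generalize Complex.exp (π / 12 * z⁻¹) = x₁ at *
  generalize Complex.exp (π / 12 * z) = x₂ at *
  field_simp at h ⊢
  linear_combination h

lemma eulerProd_eq_odd_mul {q : ℂ} (hq : ‖q‖ < 1) :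
    eulerProd q = (∏' n : ℕ, (1 - q ^ (2 * n + 1))) * eulerProd (q ^ 2) := by
  have hs : Summable fun n : ℕ ↦ ‖q‖ ^ (n + 1) :=
    (summable_nat_add_iff 1).2 (summable_geometric_of_lt_one (norm_nonneg q) hq)
  have key (g : ℕ → ℕ) (hg : Function.Injective g) : Multipliable fun n ↦ 1 - q ^ (g n + 1) := by
    have := multipliable_one_add_of_summable (f := fun n ↦ -q ^ (g n + 1))
      (by simpa [Function.comp_def] using hs.comp_injective hg)
    simpa [sub_eq_add_neg] using this
  have h := tprod_even_mul_odd (f := fun n ↦ 1 - q ^ (n + 1))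
    (key (fun n ↦ 2 * n) fun a b h ↦ by simpa using h)
    (key (fun n ↦ 2 * n + 1) fun a b h ↦ by simpa using h)
  rw [eulerProd, ← h, eulerProd]
  congr 2
  ext n
  rw [← pow_mul]
  ring

lemma eulerProd_neg_mul {q : ℂ} (hq : ‖q‖ < 1) :
    eulerProd (-q) * eulerProd q * eulerProd (q ^ 4) = eulerProd (q ^ 2) ^ 3 := by
  have hq2 : ‖q ^ 2‖ < 1 := by rw [norm_pow]; exact pow_lt_one₀ (norm_nonneg q) hq two_ne_zero
  have hs : Summable fun n : ℕ ↦ ‖q‖ ^ (n + 1) :=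
    (summable_nat_add_iff 1).2 (summable_geometric_of_lt_one (norm_nonneg q) hq)
  have key {q' : ℂ} (h : ‖q'‖ = ‖q‖) : Multipliable fun n : ℕ ↦ 1 - q' ^ (2 * n + 1) := by
    have := multipliable_one_add_of_summable (f := fun n : ℕ ↦ -q' ^ (2 * n + 1))
      (by simpa [h, Function.comp_def] using
        hs.comp_injective (i := fun n : ℕ ↦ 2 * n) fun a b h ↦ by simpa using h)
    simpa [sub_eq_add_neg] using this
  have h1 := eulerProd_eq_odd_mul (q := -q) (by simpa using hq)
  have h2 := eulerProd_eq_odd_mul hq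
  have h3 := eulerProd_eq_odd_mul hq2
  have h4 : (∏' n : ℕ, (1 - (-q) ^ (2 * n + 1))) * (∏' n : ℕ, (1 - q ^ (2 * n + 1))) =
      ∏' n : ℕ, (1 - (q ^ 2) ^ (2 * n + 1)) := by
    rw [← Multipliable.tprod_mul (key (norm_neg q)) (key rfl)]
    refine tprod_congr fun n ↦ ?_
    rw [Odd.neg_pow ⟨n, rfl⟩, ← pow_mul]
    ring
  rw [h1, h2, neg_sq]
  rw [← pow_mul] at h3
  linear_combination (eulerProd (q ^ 2) ^ 2 * eulerProd (q ^ 4)) * h4 - eulerProd (q ^ 2) ^ 2 * h3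

lemma partGF_neg_mul {q : ℂ} (hq : ‖q‖ < 1) :
    partGF (-q) * partGF q * partGF (q ^ 4) = partGF (q ^ 2) ^ 3 := by
  simp only [partGF, ← mul_inv]
  rw [eulerProd_neg_mul hq, inv_pow]

/-- The transformation of the partition generating function near `q = -1`. -/
lemma partGF_neg_exp_neg {z : ℂ} (hz : 0 < z.re) :
    partGF (-Complex.exp (-((2 * π : ℝ) * z))) = Complex.sqrt (2 * z) *
      Complex.exp (π / 12 * ((4 * z)⁻¹ - z)) *
        partGF (-Complex.exp (-((2 * π : ℝ) * (4 * z)⁻¹))) := by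
  have hz0 := ne_zero_of_re_pos hz
  have hz2 : 0 < (2 * z).re := by simpa using hz
  have hz4 : 0 < (4 * z).re := by simpa using hz
  have hq := norm_exp_neg_lt_one hz Real.two_pi_pos
  have hq' := norm_exp_neg_lt_one (inv_re_pos hz4) Real.two_pi_pos
  have h := partGF_neg_mul hq
  have h' := partGF_neg_mul hq'
  have pw (w : ℂ) (k : ℕ) : Complex.exp (-((2 * π : ℝ) * w)) ^ k =
      Complex.exp (-((2 * π : ℝ) * (k * w))) := by
    rw [← Complex.exp_nat_mul]; ring_nf
  have i2 : (2 : ℕ) * (4 * z)⁻¹ = (2 * z)⁻¹ := by push_cast; field_simp; norm_num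
  have i4 : (4 : ℕ) * (4 * z)⁻¹ = z⁻¹ := by push_cast; field_simp
  rw [pw, pw, i2, i4] at h'
  rw [pw, pw, partGF_exp_neg hz, partGF_exp_neg (z := (2 : ℕ) * z) (by simpa using hz),
    partGF_exp_neg (z := (4 : ℕ) * z) (by simpa using hz)] at h
  push_cast at h
  have s4 : Complex.sqrt (4 * z) = 2 * Complex.sqrt z := by
    have h := sqrt_ofReal_mul hz (a := 4) (by norm_num)
    have h2 : Complex.sqrt ((4 : ℝ) : ℂ) = 2 := by
      rw [Complex.sqrt, show (2⁻¹ : ℂ) = ((2⁻¹ : ℝ) : ℂ) by push_cast; rfl,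
        ← Complex.ofReal_cpow (by norm_num), show (4 : ℝ) = 2 ^ (2 : ℝ) by norm_num,
        ← Real.rpow_mul (by norm_num)]
      norm_num
    rw [h2] at h
    exact_mod_cast h
  have s0 := sqrt_ne_zero' hz0
  have s22 := sqrt_sq' (2 * z)
  have s11 := sqrt_sq' z
  rw [s4] at h
  set a := Complex.exp (π / 12 * (z⁻¹ - z))
  set b := Complex.exp (π / 12 * ((4 * z)⁻¹ - 4 * z))
  set d := Complex.exp (π / 12 * ((2 * z)⁻¹ - 2 * z))
  have hd : d ^ 3 = Complex.exp (π / 12 * ((4 * z)⁻¹ - z)) * a * b := by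
    simp only [d, a, b]
    rw [← Complex.exp_nat_mul, ← Complex.exp_add, ← Complex.exp_add]
    congr 1
    push_cast
    field_simp
    ring
  have ha : a ≠ 0 := Complex.exp_ne_zero _
  have hb : b ≠ 0 := Complex.exp_ne_zero _
  have n1 := partGF_ne_zero hq'
  have n2 := partGF_ne_zero (norm_exp_neg_lt_one (inv_re_pos hz) Real.two_pi_pos)
  push_cast at h h' n1 n2 ⊢
  have hne : 2 * Complex.sqrt z ^ 2 * a * b *
      (partGF (Complex.exp (-(2 * π * (4 * z)⁻¹))) *
        partGF (Complex.exp (-(2 * π * z⁻¹)))) ≠ 0 := by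
    refine mul_ne_zero
      (mul_ne_zero (mul_ne_zero (mul_ne_zero two_ne_zero (pow_ne_zero _ s0)) ha) hb)
      (mul_ne_zero n1 n2)
  refine mul_right_cancel₀ hne ?_
  generalize partGF (Complex.exp (-(2 * π * z⁻¹))) = X at *
  generalize partGF (Complex.exp (-(2 * π * (4 * z)⁻¹))) = Y at *
  generalize partGF (Complex.exp (-(2 * π * (2 * z)⁻¹))) = W at *
  generalize partGF (-Complex.exp (-(2 * π * (4 * z)⁻¹))) = V at *
  generalize Complex.exp (π / 12 * ((4 * z)⁻¹ - z)) = e at *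
  generalize Complex.sqrt (2 * z) = t at *
  generalize Complex.sqrt z = s at *
  linear_combination h + t ^ 3 * W ^ 3 * hd - t ^ 3 * e * a * b * h' +
    t * e * a * b * V * Y * X * (s22 - 2 * s11)

lemma p_nonneg (n : ℕ) : 0 ≤ p n := by unfold p; positivity

lemma p_zero : p 0 = 1 := by simp [p]

lemma p_le_two_pow (n : ℕ) : p (n + 1) ≤ 2 ^ n := by
  have h := Fintype.card_le_of_surjective _ (Nat.Partition.ofComposition_surj (n := n + 1))
  rw [composition_card] at h
  unfold p
  exact_mod_cast h

lemma hasSum_partGF_sub_one {q : ℂ} (hq : ‖q‖ < 1) :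
    HasSum (fun n ↦ (p (n + 1) : ℂ) * q ^ (n + 1)) (partGF q - 1) := by
  have h := (hasSum_nat_add_iff' 1).2 (hasSum_partGF hq)
  simpa [p_zero] using h

lemma norm_partGF_sub_one_le {q : ℂ} (hq : ‖q‖ < 1 / 2) :
    ‖partGF q - 1‖ ≤ ‖q‖ / (1 - 2 * ‖q‖) := by
  have h0 := norm_nonneg q
  have h := hasSum_partGF_sub_one (q := q) (by linarith)
  have hg : HasSum (fun n ↦ ‖q‖ * (2 * ‖q‖) ^ n) (‖q‖ * (1 - 2 * ‖q‖)⁻¹) :=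
    (hasSum_geometric_of_lt_one (by positivity) (by linarith)).mul_left _
  rw [← h.tsum_eq, div_eq_mul_inv]
  refine tsum_of_norm_bounded hg fun n ↦ ?_
  rw [norm_mul, norm_pow, Complex.norm_of_nonneg (p_nonneg _), mul_pow, pow_succ]
  have := p_le_two_pow n
  calc p (n + 1) * (‖q‖ ^ n * ‖q‖) ≤ 2 ^ n * (‖q‖ ^ n * ‖q‖) := by gcongr
    _ = _ := by ring

lemma norm_partGF_le {q : ℂ} (hq : ‖q‖ < 1) : ‖partGF q‖ ≤ ‖partGF (‖q‖ : ℂ)‖ := by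
  have h := hasSum_partGF hq
  have h2 := hasSum_partGF (q := (‖q‖ : ℂ)) (by simpa using hq)
  have h3 : HasSum (fun n ↦ p n * ‖q‖ ^ n) (partGF (‖q‖ : ℂ)).re := by
    have := Complex.hasSum_re h2
    refine this.congr_fun fun n ↦ ?_
    rw [← Complex.ofReal_pow, ← Complex.ofReal_mul, Complex.ofReal_re]
  rw [← h.tsum_eq]
  refine (tsum_of_norm_bounded h3 fun n ↦ ?_).trans (Complex.re_le_norm _)
  rw [norm_mul, norm_pow, Complex.norm_of_nonneg (p_nonneg _)]

lemma norm_sqrt' (z : ℂ) : ‖Complex.sqrt z‖ = √‖z‖ := by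
  rw [eq_comm, Real.sqrt_eq_iff_mul_self_eq (norm_nonneg _) (norm_nonneg _), ← norm_mul, ← sq,
    sqrt_sq']

lemma exp_neg_two_pi_lt : Real.exp (-(2 * π)) < 1 / 64 := by
  have h : Real.exp (-(2 * π)) < Real.exp (-6) := Real.exp_lt_exp.2 (by linarith [Real.pi_gt_three])
  have h2 : (2 : ℝ) ^ 6 ≤ Real.exp 1 ^ 6 := by
    gcongr
    linarith [Real.exp_one_gt_d9]
  rw [← Real.exp_nat_mul] at h2
  norm_num at h2
  rw [Real.exp_neg 6] at h
  refine h.trans_le ?_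
  rw [one_div]
  gcongr

lemma norm_partGF_le_two {q : ℂ} (hq : ‖q‖ ≤ Real.exp (-(2 * π))) : ‖partGF q‖ ≤ 2 := by
  have h := exp_neg_two_pi_lt
  have h1 := norm_partGF_sub_one_le (q := q) (by linarith)
  have h2 : ‖q‖ / (1 - 2 * ‖q‖) ≤ 1 := by
    rw [div_le_one] <;> linarith
  calc ‖partGF q‖ = ‖(partGF q - 1) + 1‖ := by ring_nf
    _ ≤ ‖partGF q - 1‖ + ‖(1 : ℂ)‖ := norm_add_le _ _
    _ ≤ 2 := by rw [norm_one]; linarith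

/-- A global bound for the partition generating function inside the unit disc. -/
lemma norm_partGF_exp_le {q : ℂ} {s : ℝ} (hs : 0 < s) (hq : ‖q‖ = Real.exp (-(2 * π * s))) :
    ‖partGF q‖ ≤ 2 * Real.exp (π / 12 / s) := by
  have hpi := Real.pi_pos
  have he : 1 ≤ Real.exp (π / 12 / s) := Real.one_le_exp (by positivity)
  rcases le_total 1 s with h1 | h1
  · have : ‖partGF q‖ ≤ 2 := norm_partGF_le_two (by rw [hq]; exact Real.exp_le_exp.2 (by nlinarith))
    linarith
  · have hq1 : ‖q‖ < 1 := by rw [hq, Real.exp_lt_one_iff]; nlinarith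
    refine (norm_partGF_le hq1).trans ?_
    have hz : 0 < (s : ℂ).re := by simpa using hs
    have e : ((‖q‖ : ℝ) : ℂ) = Complex.exp (-((2 * π : ℝ) * (s : ℂ))) := by
      rw [hq]; push_cast; rfl
    rw [e, partGF_exp_neg hz, norm_mul, norm_mul, norm_sqrt', Complex.norm_of_nonneg hs.le,
      Complex.norm_exp]
    have h2 : ‖partGF (Complex.exp (-((2 * π : ℝ) * (s : ℂ)⁻¹)))‖ ≤ 2 := by
      refine norm_partGF_le_two ?_
      rw [Complex.norm_exp]
      gcongr
      rw [← Complex.ofReal_inv, ← Complex.ofReal_mul, ← Complex.ofReal_neg, Complex.ofReal_re]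
      have : 1 ≤ s⁻¹ := (one_le_inv₀ hs).2 h1
      nlinarith
    have h3 : √s ≤ 1 := Real.sqrt_le_one.2 h1
    have h4 : (π / 12 * ((s : ℂ)⁻¹ - s)).re = π / 12 / s - π / 12 * s := by
      have : (π / 12 * ((s : ℂ)⁻¹ - s)) = ((π / 12 / s - π / 12 * s : ℝ) : ℂ) := by
        push_cast; ring
      rw [this, Complex.ofReal_re]
    rw [h4]
    have h5 : Real.exp (π / 12 / s - π / 12 * s) ≤ Real.exp (π / 12 / s) := by
      gcongr
      have : 0 < π / 12 * s := by positivity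
      linarith
    calc _ ≤ 1 * Real.exp (π / 12 / s) * 2 := by gcongr
      _ = _ := by ring

/-- The integrand of Cauchy's formula for `p n` has a primitive on the right half-plane, whose
increment over the period `I` is `I * p n`. -/
lemma exists_primitive_partGF (n : ℕ) : ∃ F : ℂ → ℂ,
    (∀ z : ℂ, 0 < z.re → HasDerivAt F
      (partGF (Complex.exp (-((2 * π : ℝ) * z))) * Complex.exp (2 * π * n * z)) z) ∧
    ∀ z, F (z + Complex.I) = F z + Complex.I * p n := by
  set g : ℕ → ℂ → ℂ := fun m z ↦ if m = n then 0 else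
    p m * Complex.exp (2 * π * (n - m) * z) / (2 * π * (n - m)) with hg
  set g' : ℕ → ℂ → ℂ := fun m z ↦ if m = n then 0 else
    p m * Complex.exp (2 * π * (n - m) * z) with hg'
  have hpi : (π : ℂ) ≠ 0 := by exact_mod_cast Real.pi_ne_zero
  have hnm {m : ℕ} (h : m ≠ n) : (2 * π * (n - m) : ℂ) ≠ 0 := by
    have : (n : ℂ) - m ≠ 0 := by
      rw [sub_ne_zero]
      exact_mod_cast h.symm
    exact mul_ne_zero (mul_ne_zero two_ne_zero hpi) this
  have hder (m : ℕ) (z : ℂ) : HasDerivAt (g m) (g' m z) z := by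
    simp only [hg, hg']
    split_ifs with h
    · exact hasDerivAt_const _ _
    · have h1 := (((hasDerivAt_id z).const_mul (2 * π * (n - m) : ℂ)).cexp.const_mul
        (p m : ℂ)).div_const (2 * π * (n - m) : ℂ)
      refine h1.congr_deriv ?_
      have := hnm h
      simp only [id, mul_one]
      rw [mul_div_assoc, mul_div_cancel_right₀ _ this]
  have hsum {z : ℂ} (hz : 0 < z.re) : HasSum (fun m ↦ g' m z)
      (partGF (Complex.exp (-((2 * π : ℝ) * z))) * Complex.exp (2 * π * n * z) - p n) := by
    have h1 := (hasSum_partGF (norm_exp_neg_lt_one hz Real.two_pi_pos)).mul_right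
      (Complex.exp (2 * π * n * z))
    have h2 := h1.sub (hasSum_ite_eq n (p n : ℂ))
    refine h2.congr_fun fun m ↦ ?_
    simp only [hg']
    rw [mul_assoc (p m : ℂ) (_ ^ m), ← Complex.exp_nat_mul, ← Complex.exp_add]
    split_ifs with h
    · subst h
      push_cast
      ring_nf
      simp
    · rw [sub_zero]
      congr 2
      push_cast
      ring
  refine ⟨fun z ↦ p n * z + ∑' m, g m z, fun z hz ↦ ?_, fun z ↦ ?_⟩
  · set t : Set ℂ := {w | z.re / 2 < w.re ∧ w.re < z.re + 1} with ht
    have ht1 : IsOpen t :=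
      (isOpen_lt continuous_const Complex.continuous_re).inter
        (isOpen_lt Complex.continuous_re continuous_const)
    have ht2 : IsPreconnected t :=
      ((convex_halfSpace_re_gt _).inter (convex_halfSpace_re_lt _)).isPreconnected
    have hzt : z ∈ t := ⟨by linarith, by linarith⟩
    set r : ℝ := Real.exp (-(π * z.re)) with hr
    have hr1 : r < 1 := by
      rw [hr, Real.exp_lt_one_iff]
      nlinarith [Real.pi_pos]
    have hu : Summable fun m ↦ p m * r ^ m * Real.exp (2 * π * n * (z.re + 1)) :=
      (summable_p_mul_pow (Real.exp_pos _).le hr1).mul_right _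
    have hb (m : ℕ) (w : ℂ) (hw : w ∈ t) :
        ‖g' m w‖ ≤ p m * r ^ m * Real.exp (2 * π * n * (z.re + 1)) := by
      simp only [hg']
      split_ifs with h
      · rw [norm_zero]
        have := p_nonneg m
        positivity
      · rw [norm_mul, Complex.norm_of_nonneg (p_nonneg m), Complex.norm_exp, hr, ← Real.exp_nat_mul,
          mul_assoc (p m), ← Real.exp_add]
        refine mul_le_mul_of_nonneg_left (Real.exp_le_exp.2 ?_) (p_nonneg m)
        have e : (2 * π * (n - m) * w : ℂ).re = 2 * π * (n - m) * w.re := by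
          rw [show (2 * π * (n - m) * w : ℂ) = ((2 * π * (n - m) : ℝ) : ℂ) * w by push_cast; ring,
            Complex.re_ofReal_mul]
        rw [e]
        have h1 : π * n * w.re ≤ π * n * (z.re + 1) := by gcongr; exact hw.2.le
        have h2 : π * m * (z.re / 2) ≤ π * m * w.re := by gcongr; exact hw.1.le
        nlinarith
    have hs : Summable fun m ↦ g m z := by
      refine Summable.of_norm_bounded hu fun m ↦ (le_trans ?_ (hb m z hzt))
      simp only [hg, hg']
      split_ifs with h
      · rfl
      · rw [norm_div]
        refine div_le_self (norm_nonneg _) ?_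
        rw [norm_mul, norm_mul, Complex.norm_ofNat, Complex.norm_of_nonneg Real.pi_pos.le]
        have h1 : (1 : ℝ) ≤ ‖(n - m : ℂ)‖ := by
          have : (n - m : ℂ) = ((n - m : ℤ) : ℂ) := by push_cast; rfl
          have h2 : (1 : ℤ) ≤ |(n - m : ℤ)| :=
            Int.one_le_abs (sub_ne_zero.2 (by exact_mod_cast Ne.symm h))
          rw [this, Complex.norm_intCast, ← Int.cast_abs]
          exact Int.cast_one_le_of_pos h2
        nlinarith [Real.pi_gt_three]
    have h := hasDerivAt_tsum_of_isPreconnected hu ht1 ht2 (fun m w _ ↦ hder m w) hb hzt hs hzt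
    rw [(hsum hz).tsum_eq] at h
    have h2 := ((hasDerivAt_id z).const_mul (p n : ℂ)).add h
    refine h2.congr_deriv ?_
    ring
  · have h : ∑' m, g m (z + Complex.I) = ∑' m, g m z := by
      refine tsum_congr fun m ↦ ?_
      simp only [hg]
      split_ifs with h
      · rfl
      · congr 2
        refine Complex.exp_eq_exp_iff_exists_int.2 ⟨n - m, ?_⟩
        push_cast
        ring
    simp only [h]
    ring

/-- The integrand of Cauchy's formula for `p n` in the variable `z` with `q = exp (-2πz)`. -/
noncomputable def cauchyInt (n : ℕ) (z : ℂ) : ℂ :=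
  partGF (Complex.exp (-((2 * π : ℝ) * z))) * Complex.exp (2 * π * n * z)

lemma cauchyInt_add_I (n : ℕ) (z : ℂ) : cauchyInt n (z + Complex.I) = cauchyInt n z := by
  unfold cauchyInt
  congr 1
  · congr 1
    refine Complex.exp_eq_exp_iff_exists_int.2 ⟨-1, ?_⟩
    push_cast
    ring
  · refine Complex.exp_eq_exp_iff_exists_int.2 ⟨n, ?_⟩
    push_cast
    ring

lemma cauchyInt_eq {n : ℕ} {ρ : ℝ} (hρ : ρ ^ 2 * (24 * n - 1) = 1) {z : ℂ} (hz : 0 < z.re) :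
    cauchyInt n z = Complex.sqrt z * Complex.exp (π / 12 * (z⁻¹ + z / ρ ^ 2)) *
      partGF (Complex.exp (-((2 * π : ℝ) * z⁻¹))) := by
  have h0 : (ρ : ℂ) ≠ 0 := by
    norm_cast
    rintro rfl
    simp at hρ
  have hρ' : (ρ : ℂ) ^ 2 * (24 * n - 1) = 1 := by exact_mod_cast hρ
  have h1 : z / ρ ^ 2 = (24 * n - 1) * z := by
    field_simp
    linear_combination (-z) * hρ'
  unfold cauchyInt
  rw [partGF_exp_neg hz, h1]
  have h2 : Complex.exp (π / 12 * (z⁻¹ + (24 * n - 1) * z)) =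
      Complex.exp (π / 12 * (z⁻¹ - z)) * Complex.exp (2 * π * n * z) := by
    rw [← Complex.exp_add]
    ring_nf
  rw [h2]
  ring

lemma cauchyInt_add_half_I_eq {n : ℕ} {ρ : ℝ} (hρ : ρ ^ 2 * (24 * n - 1) = 1) {z : ℂ}
    (hz : 0 < z.re) : cauchyInt n (z + Complex.I / 2) = (-1) ^ n * (Complex.sqrt (2 * z) *
      Complex.exp (π / 12 * ((4 * z)⁻¹ + z / ρ ^ 2)) *
        partGF (-Complex.exp (-((2 * π : ℝ) * (4 * z)⁻¹)))) := by
  have h0 : (ρ : ℂ) ≠ 0 := by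
    norm_cast
    rintro rfl
    simp at hρ
  have hρ' : (ρ : ℂ) ^ 2 * (24 * n - 1) = 1 := by exact_mod_cast hρ
  have h1 : z / ρ ^ 2 = (24 * n - 1) * z := by
    field_simp
    linear_combination (-z) * hρ'
  have h2 : Complex.exp (-((2 * π : ℝ) * (z + Complex.I / 2))) =
      -Complex.exp (-((2 * π : ℝ) * z)) := by
    rw [← Complex.exp_sub_pi_mul_I]
    push_cast
    ring_nf
  have h3 : Complex.exp (2 * π * n * (z + Complex.I / 2)) =
      (-1) ^ n * Complex.exp (2 * π * n * z) := by
    rw [← Complex.exp_pi_mul_I, ← Complex.exp_nat_mul, ← Complex.exp_add]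
    ring_nf
  have h4 : Complex.exp (π / 12 * ((4 * z)⁻¹ + (24 * n - 1) * z)) =
      Complex.exp (π / 12 * ((4 * z)⁻¹ - z)) * Complex.exp (2 * π * n * z) := by
    rw [← Complex.exp_add]
    ring_nf
  unfold cauchyInt
  rw [h2, h3, partGF_neg_exp_neg hz, h1, h4]
  ring

lemma norm_exp_neg_two_pi_mul (w : ℂ) :
    ‖Complex.exp (-((2 * π : ℝ) * w))‖ = Real.exp (-(2 * π * w.re)) := by
  rw [Complex.norm_exp, Complex.neg_re, Complex.re_ofReal_mul]

lemma re_pi_div_mul (w z : ℂ) (ρ : ℝ) :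
    (π / 12 * (w + z / ρ ^ 2) : ℂ).re = π / 12 * (w.re + z.re / ρ ^ 2) := by
  rw [show (π / 12 * (w + z / ρ ^ 2) : ℂ) = ((π / 12 : ℝ) : ℂ) * (w + z / ((ρ ^ 2 : ℝ) : ℂ)) by
    push_cast; ring, Complex.re_ofReal_mul, Complex.add_re, Complex.div_ofReal_re]

lemma norm_cauchyInt_le {n : ℕ} {ρ : ℝ} (hρ : ρ ^ 2 * (24 * n - 1) = 1) {z : ℂ}
    (hz : 0 < z.re) : ‖cauchyInt n z‖ ≤ √‖z‖ *
      Real.exp (π / 12 * (z⁻¹.re + z.re / ρ ^ 2)) * (2 * Real.exp (π / 12 / z⁻¹.re)) := by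
  rw [cauchyInt_eq hρ hz, norm_mul, norm_mul, norm_sqrt', Complex.norm_exp, re_pi_div_mul]
  gcongr
  exact norm_partGF_exp_le (inv_re_pos hz) (norm_exp_neg_two_pi_mul _)

lemma norm_cauchyInt_add_half_I_le {n : ℕ} {ρ : ℝ} (hρ : ρ ^ 2 * (24 * n - 1) = 1) {z : ℂ}
    (hz : 0 < z.re) : ‖cauchyInt n (z + Complex.I / 2)‖ ≤ √‖2 * z‖ *
      Real.exp (π / 12 * ((4 * z)⁻¹.re + z.re / ρ ^ 2)) *
        (2 * Real.exp (π / 12 / (4 * z)⁻¹.re)) := by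
  rw [cauchyInt_add_half_I_eq hρ hz, norm_mul, norm_mul, norm_mul, norm_sqrt', Complex.norm_exp,
    re_pi_div_mul, norm_pow, norm_neg, norm_one, one_pow, one_mul]
  gcongr
  refine norm_partGF_exp_le (inv_re_pos (z := 4 * z) (by simpa using hz)) ?_
  rw [norm_neg, norm_exp_neg_two_pi_mul]

lemma line_bound {ρ D : ℝ} (hρ : 0 < ρ) (hρ1 : ρ ≤ 1 / 100) (h1 : ρ ^ 2 ≤ D)
    (h2 : D ≤ (1 + 4 * ρ ^ 2) / 9) :
    √√D * Real.exp (π / 12 * (ρ / 3 / D + ρ / 3 / ρ ^ 2)) *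
      (2 * Real.exp (π / 12 / (ρ / 3 / D))) ≤ 6 / 5 * Real.exp (π / (18 * ρ)) := by
  have hD : 0 < D := lt_of_lt_of_le (by positivity) h1
  have hpi := Real.pi_pos
  have e1 : π / 12 * (ρ / 3 / D + ρ / 3 / ρ ^ 2) + π / 12 / (ρ / 3 / D) ≤
      π / (18 * ρ) + 1 / 50 := by
    have h3 : ρ ^ 2 / (3 * D) + 3 * D ≤ 1 / 3 + 5 * ρ ^ 2 := by
      rw [← sub_nonneg]
      have : 1 / 3 + 5 * ρ ^ 2 - (ρ ^ 2 / (3 * D) + 3 * D) =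
          (D + 15 * ρ ^ 2 * D - ρ ^ 2 - 9 * D ^ 2) / (3 * D) := by
        field_simp
        ring
      rw [this]
      apply div_nonneg _ (by positivity)
      nlinarith [mul_nonneg (sub_nonneg.2 h1) (sub_nonneg.2 h2), mul_pos (pow_pos hρ 2) hD,
        pow_pos hρ 4]
    have h4 : π / 12 * (ρ / 3 / D + ρ / 3 / ρ ^ 2) + π / 12 / (ρ / 3 / D) =
        π / (12 * ρ) * (1 / 3 + (ρ ^ 2 / (3 * D) + 3 * D)) := by
      field_simp
      ring
    rw [h4]
    calc π / (12 * ρ) * (1 / 3 + (ρ ^ 2 / (3 * D) + 3 * D))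
        ≤ π / (12 * ρ) * (1 / 3 + (1 / 3 + 5 * ρ ^ 2)) := by gcongr
      _ = π / (18 * ρ) + 5 * π * ρ / 12 := by field_simp; ring
      _ ≤ _ := by nlinarith [Real.pi_lt_d2]
  have e2 : √√D ≤ 29 / 50 := by
    rw [Real.sqrt_le_left (by norm_num), Real.sqrt_le_left (by norm_num)]
    nlinarith
  have e3 : Real.exp (1 / 50) ≤ 103 / 100 := by
    have := Real.exp_bound_div_one_sub_of_interval' (x := 1 / 50) (by norm_num) (by norm_num)
    linarith
  calc _ = √√D * 2 * Real.exp (π / 12 * (ρ / 3 / D + ρ / 3 / ρ ^ 2) + π / 12 / (ρ / 3 / D)) := by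
        rw [Real.exp_add]; ring
    _ ≤ 29 / 50 * 2 * Real.exp (π / (18 * ρ) + 1 / 50) := by gcongr
    _ = 29 / 50 * 2 * Real.exp (1 / 50) * Real.exp (π / (18 * ρ)) := by rw [Real.exp_add]; ring
    _ ≤ _ := by
      gcongr
      linarith

lemma norm_cauchyInt_le_of_line {n : ℕ} {ρ : ℝ} (hρn : ρ ^ 2 * (24 * n - 1) = 1) (hρ : 0 < ρ)
    (hρ1 : ρ ≤ 1 / 100) {z : ℂ} (hz : z.re = ρ / 3) (h1 : ρ ^ 2 ≤ Complex.normSq z)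
    (h2 : |z.im| ≤ 1 / 3) : ‖cauchyInt n z‖ ≤ 6 / 5 * Real.exp (π / (18 * ρ)) := by
  have hz0 : 0 < z.re := by rw [hz]; positivity
  refine (norm_cauchyInt_le hρn hz0).trans ?_
  rw [Complex.inv_re, hz, Complex.norm_def]
  refine line_bound hρ hρ1 h1 ?_
  rw [Complex.normSq_apply, hz]
  nlinarith [abs_le.1 h2]

lemma norm_cauchyInt_add_half_I_le_of_line {n : ℕ} {ρ : ℝ} (hρn : ρ ^ 2 * (24 * n - 1) = 1)
    (hρ : 0 < ρ) (hρ1 : ρ ≤ 1 / 100) {z : ℂ} (hz : z.re = ρ / 3)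
    (h1 : ρ ^ 2 ≤ 4 * Complex.normSq z) (h2 : |z.im| ≤ 1 / 6) :
    ‖cauchyInt n (z + Complex.I / 2)‖ ≤ 6 / 5 * Real.exp (π / (18 * ρ)) := by
  have hz0 : 0 < z.re := by rw [hz]; positivity
  refine (norm_cauchyInt_add_half_I_le hρn hz0).trans ?_
  have e : (4 * z)⁻¹.re = ρ / 3 / (4 * Complex.normSq z) := by
    have h4 : (4 * z).re = 4 * (ρ / 3) := by simp [hz]
    rw [Complex.inv_re, map_mul, h4, Complex.normSq_ofNat]
    have := Complex.normSq_pos.2 (ne_zero_of_re_pos hz0)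
    field_simp
  have e2 : ‖2 * z‖ = √(4 * Complex.normSq z) := by
    rw [norm_mul, Complex.norm_ofNat, Real.sqrt_mul (by norm_num), Complex.norm_def,
      show (4 : ℝ) = 2 ^ 2 by norm_num, Real.sqrt_sq (by norm_num)]
  rw [e, hz, e2]
  refine line_bound hρ hρ1 h1 ?_
  rw [Complex.normSq_apply, hz]
  nlinarith [abs_le.1 h2]

lemma continuousOn_cauchyInt (n : ℕ) : ContinuousOn (cauchyInt n) {z | 0 < z.re} := by
  obtain ⟨F, hF, -⟩ := exists_primitive_partGF n
  have ho : IsOpen {z : ℂ | 0 < z.re} := isOpen_lt continuous_const Complex.continuous_re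
  have hd : DifferentiableOn ℂ F {z | 0 < z.re} := fun z hz ↦
    (hF z hz).differentiableAt.differentiableWithinAt
  exact ((hd.deriv ho).continuousOn).congr fun z hz ↦ (hF z hz).deriv.symm

lemma primitive_circleMap_sub {n : ℕ} {F : ℂ → ℂ}
    (hF : ∀ z : ℂ, 0 < z.re → HasDerivAt F (cauchyInt n z) z) {c : ℂ} {r a b : ℝ}
    (h : ∀ θ ∈ Set.uIcc a b, 0 < (circleMap c r θ).re) :
    F (circleMap c r b) - F (circleMap c r a) =
      ∫ θ in a..b, cauchyInt n (circleMap c r θ) * (circleMap 0 r θ * Complex.I) := by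
  refine (intervalIntegral.integral_eq_sub_of_hasDerivAt
    (f := fun θ ↦ F (circleMap c r θ)) (fun θ hθ ↦ ?_) ?_).symm
  · exact (hF _ (h θ hθ)).comp_of_eq θ (hasDerivAt_circleMap c r θ) rfl
  · refine ContinuousOn.intervalIntegrable ?_
    refine ContinuousOn.mul ?_ (by fun_prop)
    exact (continuousOn_cauchyInt n).comp (continuous_circleMap c r).continuousOn h

lemma primitive_sub_le_of_line {n : ℕ} {F : ℂ → ℂ}
    (hF : ∀ z : ℂ, 0 < z.re → HasDerivAt F (cauchyInt n z) z) {x u v M : ℝ} (hx : 0 < x)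
    (huv : u ≤ v) (hM : ∀ z : ℂ, z.re = x → u ≤ z.im → z.im ≤ v → ‖cauchyInt n z‖ ≤ M) :
    ‖F (x + v * Complex.I) - F (x + u * Complex.I)‖ ≤ M * (v - u) := by
  have hs : Convex ℝ (({x} : Set ℝ) ×ℂ Set.Icc u v) :=
    ((convex_singleton x).linear_preimage Complex.reLm).inter
      ((convex_Icc u v).linear_preimage Complex.imLm)
  have h := hs.norm_image_sub_le_of_norm_hasDerivWithin_le (f := F) (f' := cauchyInt n) (C := M)
    (x := x + u * Complex.I) (y := x + v * Complex.I) (fun z hz ↦ ?_) (fun z hz ↦ ?_) ?_ ?_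
  · refine h.trans (le_of_eq ?_)
    rw [show (x + v * Complex.I - (x + u * Complex.I) : ℂ) = ((v - u : ℝ) : ℂ) * Complex.I by
      push_cast; ring, norm_mul, Complex.norm_I, mul_one, Complex.norm_of_nonneg (by linarith)]
  · have hz' : z.re = x := hz.1
    exact (hF z (by rw [hz']; exact hx)).hasDerivWithinAt
  · exact hM z hz.1 hz.2.1 hz.2.2
  · simp [Complex.mem_reProdIm, huv]
  · simp [Complex.mem_reProdIm, huv]

lemma norm_cauchyInt_le_of_lower {n : ℕ} {ρ s t : ℝ} (hρn : ρ ^ 2 * (24 * n - 1) = 1)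
    (hρ : 0 < ρ) (hρ1 : ρ ≤ 1 / 100) (hs : 0 ≤ s) (hs2 : s ^ 2 = 8 / 9 * ρ ^ 2) (ht : 0 ≤ t)
    (ht2 : t ^ 2 = 5 / 36 * ρ ^ 2) {z : ℂ} (hz : z.re = ρ / 3) (h1 : s ≤ z.im)
    (h2 : z.im ≤ 1 / 2 - t) : ‖cauchyInt n z‖ ≤ 6 / 5 * Real.exp (π / (18 * ρ)) := by
  rcases le_total z.im (1 / 3) with h | h
  · refine norm_cauchyInt_le_of_line hρn hρ hρ1 hz ?_ ?_
    · rw [Complex.normSq_apply, hz]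
      nlinarith
    · rw [abs_le]
      constructor <;> linarith
  · rw [show z = (z - Complex.I / 2) + Complex.I / 2 by ring]
    have e : (z - Complex.I / 2).im = z.im - 1 / 2 := by simp
    refine norm_cauchyInt_add_half_I_le_of_line hρn hρ hρ1 (by simp [hz]) ?_ ?_
    · rw [Complex.normSq_apply, e, show (z - Complex.I / 2).re = ρ / 3 by simp [hz]]
      nlinarith
    · rw [e, abs_le]
      constructor <;> linarith

lemma norm_cauchyInt_le_of_upper {n : ℕ} {ρ s t : ℝ} (hρn : ρ ^ 2 * (24 * n - 1) = 1)
    (hρ : 0 < ρ) (hρ1 : ρ ≤ 1 / 100) (hs : 0 ≤ s) (hs2 : s ^ 2 = 8 / 9 * ρ ^ 2) (ht : 0 ≤ t)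
    (ht2 : t ^ 2 = 5 / 36 * ρ ^ 2) {z : ℂ} (hz : z.re = ρ / 3) (h1 : 1 / 2 + t ≤ z.im)
    (h2 : z.im ≤ 1 - s) : ‖cauchyInt n z‖ ≤ 6 / 5 * Real.exp (π / (18 * ρ)) := by
  rcases le_total z.im (2 / 3) with h | h
  · rw [show z = (z - Complex.I / 2) + Complex.I / 2 by ring]
    have e : (z - Complex.I / 2).im = z.im - 1 / 2 := by simp
    refine norm_cauchyInt_add_half_I_le_of_line hρn hρ hρ1 (by simp [hz]) ?_ ?_
    · rw [Complex.normSq_apply, e, show (z - Complex.I / 2).re = ρ / 3 by simp [hz]]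
      nlinarith
    · rw [e, abs_le]
      constructor <;> linarith
  · rw [show z = (z - Complex.I) + Complex.I by ring, cauchyInt_add_I]
    have e : (z - Complex.I).im = z.im - 1 := by simp
    refine norm_cauchyInt_le_of_line hρn hρ hρ1 (by simp [hz]) ?_ ?_
    · rw [Complex.normSq_apply, e, show (z - Complex.I).re = ρ / 3 by simp [hz]]
      nlinarith
    · rw [e, abs_le]
      constructor <;> linarith

lemma circleMap_re_im (c : ℂ) (r θ : ℝ) : circleMap c r θ =
    c + (r * Real.cos θ : ℝ) + (r * Real.sin θ : ℝ) * Complex.I := by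
  rw [circleMap, Complex.exp_mul_I]
  push_cast
  ring

lemma le_cos_of_mem {a θ : ℝ} (ha : -1 ≤ a) (ha1 : a ≤ 1)
    (h : θ ∈ Set.Icc (-Real.arccos a) (Real.arccos a)) : a ≤ Real.cos θ := by
  rw [← Real.cos_abs, ← Real.cos_arccos ha ha1]
  exact Real.cos_le_cos_of_nonneg_of_le_pi (abs_nonneg θ) (Real.arccos_le_pi a) (abs_le.2 h)

lemma norm_primitive_half_arc_le {n : ℕ} {F : ℂ → ℂ}
    (hF : ∀ z : ℂ, 0 < z.re → HasDerivAt F (cauchyInt n z) z) {ρ : ℝ}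
    (hρn : ρ ^ 2 * (24 * n - 1) = 1) (hρ : 0 < ρ) (hρ1 : ρ ≤ 1 / 100) :
    ‖F (circleMap (Complex.I / 2) (ρ / 2) (Real.arccos (2 / 3))) -
      F (circleMap (Complex.I / 2) (ρ / 2) (-Real.arccos (2 / 3)))‖ ≤
      262 / 100 * ρ ^ 2 * Real.exp (π / (12 * ρ)) := by
  set T := Real.arccos (2 / 3) with hT
  have hpi := Real.pi_pos
  have hT0 : 0 ≤ T := Real.arccos_nonneg _
  have hT1 : T ≤ 1 := by
    have : Real.cos 1 ≤ 2 / 3 := Real.cos_one_le.trans (by norm_num)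
    have h := Real.arccos_le_arccos this
    rwa [Real.arccos_cos (by norm_num) (by linarith [Real.pi_gt_three])] at h
  have hu : Set.uIcc (-T) T = Set.Icc (-T) T := Set.uIcc_of_le (by linarith)
  have hcos {θ : ℝ} (hθ : θ ∈ Set.Icc (-T) T) : 2 / 3 ≤ Real.cos θ :=
    le_cos_of_mem (by norm_num) (by norm_num) hθ
  have hre {θ : ℝ} (hθ : θ ∈ Set.Icc (-T) T) : 0 < (circleMap 0 (ρ / 2) θ).re := by
    have := hcos hθ
    rw [circleMap_re_im]
    simp
    positivity
  have hc (θ : ℝ) :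
      circleMap (Complex.I / 2) (ρ / 2) θ = circleMap 0 (ρ / 2) θ + Complex.I / 2 := by
    simp [circleMap]; ring
  rw [primitive_circleMap_sub hF (fun θ hθ ↦ by
    rw [hu] at hθ; rw [hc]; simpa using hre hθ)]
  set b : ℝ := 43 / 96 * (π / (12 * ρ)) with hb
  have hb0 : 0 < b := by positivity
  set K : ℝ := ρ / 2 * √ρ * (101 / 100) * Real.exp (π / (12 * ρ)) with hK
  have hK0 : 0 ≤ K := by positivity
  have h_gauss : MeasureTheory.Integrable fun θ : ℝ ↦ K * Real.exp (-b * θ ^ 2) :=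
    (integrable_exp_neg_mul_sq hb0).const_mul K
  have hbound : ∀ θ ∈ Set.Icc (-T) T, ‖cauchyInt n (circleMap (Complex.I / 2) (ρ / 2) θ) *
      (circleMap 0 (ρ / 2) θ * Complex.I)‖ ≤ K * Real.exp (-b * θ ^ 2) := by
    intro θ hθ
    have h1 := hcos hθ
    have hz := hre hθ
    rw [hc, cauchyInt_add_half_I_eq hρn hz]
    set z := circleMap 0 (ρ / 2) θ with hz'
    have hzn : ‖z‖ = ρ / 2 := by rw [hz', norm_circleMap_zero, abs_of_pos (by positivity)]
    have hzr : z.re = ρ / 2 * Real.cos θ := by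
      rw [hz', circleMap_re_im, zero_add, Complex.add_re, Complex.ofReal_re]; simp
    have hinv : (4 * z)⁻¹.re = Real.cos θ / (2 * ρ) := by
      have h4 : (4 * z).re = 4 * (ρ / 2 * Real.cos θ) := by simp [hzr]
      rw [Complex.inv_re, h4, Complex.normSq_eq_norm_sq, norm_mul, hzn, Complex.norm_ofNat]
      field_simp
      ring
    set q := Complex.exp (-((2 * π : ℝ) * (4 * z)⁻¹)) with hq
    have hqn : ‖q‖ ≤ 1 / 204 := by
      rw [hq, norm_exp_neg_two_pi_mul, hinv, Real.exp_neg, one_div]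
      gcongr
      have h2 : 203 ≤ 2 * π * (Real.cos θ / (2 * ρ)) := by
        rw [mul_div_assoc', le_div_iff₀ (by positivity)]
        nlinarith [Real.pi_gt_d2]
      linarith [Real.add_one_le_exp (2 * π * (Real.cos θ / (2 * ρ)))]
    have hP : ‖partGF (-q)‖ ≤ 101 / 100 := by
      have h3 := norm_partGF_sub_one_le (q := -q) (by rw [norm_neg]; linarith)
      rw [norm_neg] at h3
      have h4 : ‖q‖ / (1 - 2 * ‖q‖) ≤ 1 / 100 := by
        rw [div_le_iff₀] <;> linarith
      calc ‖partGF (-q)‖ = ‖(partGF (-q) - 1) + 1‖ := by ring_nf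
        _ ≤ ‖partGF (-q) - 1‖ + ‖(1 : ℂ)‖ := norm_add_le _ _
        _ ≤ _ := by rw [norm_one]; linarith
    have hexp : π / 12 * ((4 * z)⁻¹.re + z.re / ρ ^ 2) ≤ π / (12 * ρ) + -b * θ ^ 2 := by
      have h5 : Real.cos θ ≤ 1 - 43 / 96 * θ ^ 2 := by
        have habs : |θ| ≤ 1 := abs_le.2 ⟨by linarith [hθ.1], by linarith [hθ.2]⟩
        have h6 := (abs_le.1 (Real.cos_bound habs)).2
        have h7 : |θ| ^ 4 = θ ^ 2 * θ ^ 2 := by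
          rw [show 4 = 2 * 2 by norm_num, pow_mul, sq_abs]; ring
        have h8 : θ ^ 2 ≤ 1 := (sq_le_one_iff_abs_le_one θ).2 habs
        nlinarith [sq_nonneg θ]
      have h9 : π / 12 * ((4 * z)⁻¹.re + z.re / ρ ^ 2) = π / (12 * ρ) * Real.cos θ := by
        rw [hinv, hzr]
        field_simp
        ring
      rw [h9, hb]
      calc π / (12 * ρ) * Real.cos θ ≤ π / (12 * ρ) * (1 - 43 / 96 * θ ^ 2) := by gcongr
        _ = _ := by ring
    rw [norm_mul, norm_mul, norm_mul, norm_mul, norm_mul, norm_sqrt', Complex.norm_exp,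
      re_pi_div_mul, norm_pow, norm_neg, norm_one, one_pow, one_mul, Complex.norm_I, mul_one,
      norm_mul, hzn, Complex.norm_ofNat, mul_div_cancel₀ _ two_ne_zero]
    calc √ρ * Real.exp (π / 12 * ((4 * z)⁻¹.re + z.re / ρ ^ 2)) * ‖partGF (-q)‖ * (ρ / 2)
        ≤ √ρ * Real.exp (π / (12 * ρ) + -b * θ ^ 2) * (101 / 100) * (ρ / 2) := by gcongr
      _ = _ := by rw [Real.exp_add, hK]; ring
  refine (intervalIntegral.norm_integral_le_of_norm_le (by linarith)
    (MeasureTheory.ae_of_all _ fun θ hθ ↦ hbound θ (Set.Ioc_subset_Icc_self hθ))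
    h_gauss.intervalIntegrable).trans ?_
  rw [intervalIntegral.integral_of_le (by linarith)]
  refine (MeasureTheory.setIntegral_le_integral h_gauss
    (MeasureTheory.ae_of_all _ fun θ ↦ by positivity)).trans ?_
  rw [MeasureTheory.integral_const_mul, integral_gaussian]
  have h1 : √(π / b) ≤ √ρ * (518 / 100) := by
    rw [← Real.sqrt_sq (show (0 : ℝ) ≤ 518 / 100 by norm_num), ← Real.sqrt_mul hρ.le]
    apply Real.sqrt_le_sqrt
    rw [hb]
    field_simp
    norm_num
  calc K * √(π / b) ≤ K * (√ρ * (518 / 100)) := by gcongr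
    _ = (√ρ * √ρ) * (ρ / 2 * (101 / 100) * (518 / 100)) * Real.exp (π / (12 * ρ)) := by
      rw [hK]; ring
    _ = (101 / 100 * (518 / 200)) * ρ ^ 2 * Real.exp (π / (12 * ρ)) := by
      rw [Real.mul_self_sqrt hρ.le]; ring
    _ ≤ _ := by
      gcongr
      norm_num

lemma sqrt_ofReal_mul_exp {r θ : ℝ} (hr : 0 < r) (hθ : θ ∈ Set.Ioo (-π) π) :
    Complex.sqrt (circleMap 0 r θ) = √r * Complex.exp (θ / 2 * Complex.I) := by
  have h1 : Complex.sqrt (Complex.exp (θ * Complex.I)) = Complex.exp (θ / 2 * Complex.I) := by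
    rw [Complex.sqrt, Complex.cpow_def_of_ne_zero (Complex.exp_ne_zero _), Complex.log_exp]
    · ring_nf
    · simpa using hθ.1
    · simpa using hθ.2.le
  have h2 : Complex.sqrt (r : ℂ) = √r := by
    rw [Complex.sqrt, show (2⁻¹ : ℂ) = ((2⁻¹ : ℝ) : ℂ) by push_cast; rfl,
      ← Complex.ofReal_cpow hr.le, Real.sqrt_eq_rpow]
    norm_num
  rw [circleMap_zero, sqrt_mul_of_arg (by exact_mod_cast hr.ne') (Complex.exp_ne_zero _), h1, h2]
  rw [Complex.arg_ofReal_of_nonneg hr.le, Complex.arg_exp_mul_I, zero_add]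
  have := toIocMod_mem_Ioc Real.two_pi_pos (-π) θ
  rwa [show -π + 2 * π = π by ring] at this

lemma norm_primitive_arc_sub_le {n : ℕ} {F : ℂ → ℂ}
    (hF : ∀ z : ℂ, 0 < z.re → HasDerivAt F (cauchyInt n z) z) {ρ : ℝ}
    (hρn : ρ ^ 2 * (24 * n - 1) = 1) (hρ : 0 < ρ) (hρ1 : ρ ≤ 1 / 100) {T : ℝ}
    (hT : T = Real.arccos (1 / 3)) :
    ‖F (circleMap 0 ρ T) - F (circleMap 0 ρ (-T)) -
      ∫ θ in -T..T, Complex.I * (ρ * √ρ) * (Complex.exp (3 / 2 * θ * Complex.I) *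
        Complex.exp (π / (6 * ρ) * Real.cos θ : ℝ))‖ ≤ 2 * π * (ρ * √ρ) := by
  have hpi := Real.pi_pos
  have hT0 : 0 ≤ T := by rw [hT]; exact Real.arccos_nonneg _
  have hT1 : T ≤ π / 2 := by rw [hT, Real.arccos_le_pi_div_two]; norm_num
  have hu : Set.uIcc (-T) T = Set.Icc (-T) T := Set.uIcc_of_le (by linarith)
  have hcos {θ : ℝ} (hθ : θ ∈ Set.Icc (-T) T) : 1 / 3 ≤ Real.cos θ :=
    le_cos_of_mem (by norm_num) (by norm_num) (by rwa [hT] at hθ)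
  have hre {θ : ℝ} (hθ : θ ∈ Set.Icc (-T) T) : 0 < (circleMap 0 ρ θ).re := by
    have := hcos hθ
    rw [circleMap_re_im]
    simp
    positivity
  have hre' : ∀ θ ∈ Set.uIcc (-T) T, 0 < (circleMap 0 ρ θ).re := fun θ hθ ↦ hre (by rwa [hu] at hθ)
  rw [primitive_circleMap_sub hF hre', ← intervalIntegral.integral_sub]
  rotate_left
  · refine ContinuousOn.intervalIntegrable (ContinuousOn.mul ?_ (by fun_prop))
    exact (continuousOn_cauchyInt n).comp (continuous_circleMap 0 ρ).continuousOn hre'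
  · refine Continuous.intervalIntegrable ?_ _ _
    fun_prop
  refine (intervalIntegral.norm_integral_le_of_norm_le_const (C := 2 * (ρ * √ρ))
    fun θ hθ ↦ ?_).trans ?_
  · have hθ' : θ ∈ Set.Icc (-T) T := by
      rw [Set.uIoc_of_le (by linarith)] at hθ
      exact Set.Ioc_subset_Icc_self hθ
    have hz := hre hθ'
    have h1 := hcos hθ'
    rw [cauchyInt_eq hρn hz, sqrt_ofReal_mul_exp hρ ⟨by linarith [hθ'.1], by linarith [hθ'.2]⟩]
    set z := circleMap 0 ρ θ with hz'
    have hρc : (ρ : ℂ) ≠ 0 := by exact_mod_cast hρ.ne'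
    have hzinv : z⁻¹ = (ρ : ℂ)⁻¹ * Complex.exp (-(θ * Complex.I)) := by
      rw [hz', circleMap_zero, mul_inv, Complex.exp_neg]
    have hinv : z⁻¹.re = Real.cos θ / ρ := by
      rw [hzinv, ← Complex.ofReal_inv, Complex.re_ofReal_mul,
        show -(θ * Complex.I) = ((-θ : ℝ) : ℂ) * Complex.I by push_cast; ring,
        Complex.exp_ofReal_mul_I_re, Real.cos_neg]
      field_simp
    have hexp : (π / 12 * (z⁻¹ + z / ρ ^ 2) : ℂ) = ((π / (6 * ρ) * Real.cos θ : ℝ) : ℂ) := by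
      rw [hzinv, hz', circleMap_zero]
      push_cast
      rw [Complex.cos, neg_mul]
      field_simp
      ring
    have hsplit : z * Complex.I = Complex.I * ρ * Complex.exp (θ * Complex.I) := by
      rw [hz', circleMap_zero]; ring
    have h3 : Complex.exp (θ / 2 * Complex.I) * Complex.exp (θ * Complex.I) =
        Complex.exp (3 / 2 * θ * Complex.I) := by
      rw [← Complex.exp_add]; ring_nf
    set q := Complex.exp (-((2 * π : ℝ) * z⁻¹)) with hq
    have hqr : ‖q‖ = Real.exp (-(2 * π * (Real.cos θ / ρ))) := by
      rw [hq, norm_exp_neg_two_pi_mul, hinv]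
    have hqn : ‖q‖ ≤ 1 / 64 := by
      refine le_trans ?_ exp_neg_two_pi_lt.le
      rw [hqr]
      refine Real.exp_le_exp.2 ?_
      have : 1 ≤ Real.cos θ / ρ := by
        rw [le_div_iff₀ hρ]; linarith
      nlinarith
    have hP : ‖partGF q - 1‖ ≤ 2 * ‖q‖ := by
      refine (norm_partGF_sub_one_le (by linarith)).trans ?_
      rw [div_le_iff₀ (by linarith)]
      nlinarith [norm_nonneg q]
    have hfac : ((√ρ : ℂ) * Complex.exp (θ / 2 * Complex.I) *
        Complex.exp (π / 12 * (z⁻¹ + z / ρ ^ 2)) * partGF q) * (z * Complex.I) -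
        Complex.I * (ρ * √ρ) * (Complex.exp (3 / 2 * θ * Complex.I) *
          Complex.exp (π / (6 * ρ) * Real.cos θ : ℝ)) =
        ((ρ * √ρ : ℝ) : ℂ) * Complex.I * Complex.exp (((3 / 2 * θ : ℝ) : ℂ) * Complex.I) *
          Complex.exp (π / (6 * ρ) * Real.cos θ : ℝ) * (partGF q - 1) := by
      rw [hexp, hsplit]
      push_cast
      rw [← h3]
      ring
    rw [hfac, norm_mul, norm_mul, norm_mul, norm_mul, Complex.norm_exp_ofReal_mul_I,
      Complex.norm_I, mul_one, mul_one, Complex.norm_of_nonneg (by positivity),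
      ← Complex.ofReal_exp, Complex.norm_of_nonneg (Real.exp_pos _).le]
    have hfin : Real.exp (π / (6 * ρ) * Real.cos θ) * ‖q‖ ≤ 1 := by
      rw [hqr, ← Real.exp_add, Real.exp_le_one_iff]
      have e : π / (6 * ρ) * Real.cos θ + -(2 * π * (Real.cos θ / ρ)) =
          -(11 / 6 * (π * Real.cos θ / ρ)) := by
        field_simp
        ring
      rw [e]
      have : 0 ≤ π * Real.cos θ / ρ := by positivity
      linarith
    calc ρ * √ρ * Real.exp (π / (6 * ρ) * Real.cos θ) * ‖partGF q - 1‖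
        ≤ ρ * √ρ * Real.exp (π / (6 * ρ) * Real.cos θ) * (2 * ‖q‖) := by gcongr
      _ = 2 * (ρ * √ρ) * (Real.exp (π / (6 * ρ) * Real.cos θ) * ‖q‖) := by ring
      _ ≤ 2 * (ρ * √ρ) * 1 := by gcongr
      _ = _ := mul_one _
  · rw [abs_of_nonneg (by linarith)]
    have : 0 ≤ ρ * √ρ := by positivity
    nlinarith

lemma integral_gaussian_truncated {μ W : ℝ} (hμ : 1 ≤ μ) (hW : 0 ≤ W) (hW2 : W ^ 2 = 1 / 3) :
    |(∫ w in -W..W, 2 * (1 - 4 * w ^ 2) * Real.exp (μ * (1 - 2 * w ^ 2))) -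
      2 * (1 - 1 / μ) * √(π / (2 * μ)) * Real.exp μ| ≤ 8 * Real.exp (μ / 3) := by
  have hμ0 : 0 < μ := by linarith
  have hg (b : ℝ) : Continuous fun w : ℝ ↦ Real.exp (-b * w ^ 2) := by fun_prop
  have h1 : (∫ w in -W..W, 2 * (1 - 4 * w ^ 2) * Real.exp (μ * (1 - 2 * w ^ 2))) =
      2 * (1 - 1 / μ) * Real.exp μ * (∫ w in -W..W, Real.exp (-(2 * μ) * w ^ 2)) +
        4 / μ * W * Real.exp (μ / 3) := by
    have h2 : ∫ w in -W..W, 2 / μ * Real.exp μ * (1 * Real.exp (-(2 * μ) * w ^ 2) +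
        w * (Real.exp (-(2 * μ) * w ^ 2) * (-(2 * μ) * (2 * w)))) =
        2 / μ * Real.exp μ * (W * Real.exp (-(2 * μ) * W ^ 2) -
          (-W) * Real.exp (-(2 * μ) * (-W) ^ 2)) := by
      rw [intervalIntegral.integral_const_mul]
      congr 1
      refine intervalIntegral.integral_eq_sub_of_hasDerivAt
        (f := fun w ↦ w * Real.exp (-(2 * μ) * w ^ 2)) (fun w _ ↦ ?_)
        (Continuous.intervalIntegrable (by fun_prop) _ _)
      refine (hasDerivAt_id w).mul ?_
      refine HasDerivAt.exp ?_
      simpa using (hasDerivAt_pow 2 w).const_mul (-(2 * μ))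
    have h3 : 4 / μ * W * Real.exp (μ / 3) = 2 / μ * Real.exp μ *
        (W * Real.exp (-(2 * μ) * W ^ 2) - (-W) * Real.exp (-(2 * μ) * (-W) ^ 2)) := by
      rw [neg_sq, hW2, show μ / 3 = μ + -(2 * μ) * (1 / 3) by ring, Real.exp_add]
      ring
    rw [h3, ← h2, ← intervalIntegral.integral_const_mul, ← intervalIntegral.integral_add
      (Continuous.intervalIntegrable (by fun_prop) _ _)
      (Continuous.intervalIntegrable (by fun_prop) _ _)]
    refine intervalIntegral.integral_congr fun w _ ↦ ?_
    rw [show μ * (1 - 2 * w ^ 2) = μ + -(2 * μ) * w ^ 2 by ring, Real.exp_add]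
    field_simp
    ring
  have h_gauss (b : ℝ) (hb : 0 < b) := integrable_exp_neg_mul_sq hb
  have h4 : |(∫ w in -W..W, Real.exp (-(2 * μ) * w ^ 2)) - √(π / (2 * μ))| ≤
      Real.exp (-(2 * (μ - 1)) * (1 / 3)) * √(π / 2) := by
    rw [← integral_gaussian (2 * μ), intervalIntegral.integral_of_le (by linarith), abs_sub_comm,
      ← MeasureTheory.integral_add_compl measurableSet_Ioc (h_gauss (2 * μ) (by positivity)),
      add_sub_cancel_left, abs_of_nonneg
        (MeasureTheory.setIntegral_nonneg measurableSet_Ioc.compl fun _ _ ↦ (Real.exp_pos _).le),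
      ← integral_gaussian 2, ← MeasureTheory.integral_const_mul]
    have hi := (h_gauss 2 (by norm_num)).const_mul (Real.exp (-(2 * (μ - 1)) * (1 / 3)))
    refine (MeasureTheory.setIntegral_mono_on (h_gauss (2 * μ) (by positivity)).integrableOn
      hi.integrableOn measurableSet_Ioc.compl fun w hw ↦ ?_).trans
      (MeasureTheory.setIntegral_le_integral hi (MeasureTheory.ae_of_all _ fun w ↦ by positivity))
    rw [← Real.exp_add, Real.exp_le_exp]
    have hw2 : 1 / 3 ≤ w ^ 2 := by
      rw [← hW2]
      simp only [Set.mem_compl_iff, Set.mem_Ioc, not_and_or, not_lt, not_le] at hw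
      rcases hw with hw | hw <;> nlinarith
    nlinarith
  have h5 : √(π / 2) ≤ 13 / 10 := by
    rw [Real.sqrt_le_left (by norm_num)]
    linarith [Real.pi_lt_d2]
  have h6 : Real.exp μ * Real.exp (-(2 * (μ - 1)) * (1 / 3)) ≤ 2 * Real.exp (μ / 3) := by
    rw [← Real.exp_add, show μ + -(2 * (μ - 1)) * (1 / 3) = 2 / 3 + μ / 3 by ring, Real.exp_add]
    gcongr
    rw [← Real.le_log_iff_exp_le (by norm_num)]
    linarith [Real.log_two_gt_d9]
  have h7 : W ≤ 3 / 5 := by nlinarith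
  have h8 : 0 ≤ 1 / μ := by positivity
  have h9 : 1 / μ ≤ 1 := by rw [div_le_one hμ0]; exact hμ
  rw [h1]
  set G := ∫ w in -W..W, Real.exp (-(2 * μ) * w ^ 2)
  have h10 : 2 * (1 - 1 / μ) * Real.exp μ * G + 4 / μ * W * Real.exp (μ / 3) -
      2 * (1 - 1 / μ) * √(π / (2 * μ)) * Real.exp μ =
      2 * (1 - 1 / μ) * Real.exp μ * (G - √(π / (2 * μ))) + 4 * (1 / μ) * W * Real.exp (μ / 3) := by
    ring
  rw [h10]
  refine (abs_add_le _ _).trans ?_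
  rw [abs_mul, abs_of_nonneg (mul_nonneg (by linarith) (Real.exp_pos _).le),
    abs_of_nonneg (show 0 ≤ 4 * (1 / μ) * W * Real.exp (μ / 3) by positivity)]
  calc _ ≤ 2 * 1 * Real.exp μ * (Real.exp (-(2 * (μ - 1)) * (1 / 3)) * (13 / 10)) +
        4 * 1 * (3 / 5) * Real.exp (μ / 3) := by
        gcongr
        · linarith
        · exact h4.trans (by gcongr)
    _ = 26 / 10 * (Real.exp μ * Real.exp (-(2 * (μ - 1)) * (1 / 3))) +
        12 / 5 * Real.exp (μ / 3) := by ring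
    _ ≤ 26 / 10 * (2 * Real.exp (μ / 3)) + 12 / 5 * Real.exp (μ / 3) := by gcongr
    _ ≤ _ := by linarith [Real.exp_pos (μ / 3)]

lemma integral_cos_mul_exp_cos (μ T : ℝ) :
    ∫ θ in -T..T, Real.cos (3 / 2 * θ) * Real.exp (μ * Real.cos θ) =
      ∫ w in -Real.sin (T / 2)..Real.sin (T / 2),
        2 * (1 - 4 * w ^ 2) * Real.exp (μ * (1 - 2 * w ^ 2)) := by
  have h := intervalIntegral.integral_comp_mul_deriv (a := -T) (b := T)
    (f := fun θ ↦ Real.sin (θ / 2)) (f' := fun θ ↦ Real.cos (θ / 2) * (1 / 2))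
    (g := fun w ↦ 2 * (1 - 4 * w ^ 2) * Real.exp (μ * (1 - 2 * w ^ 2)))
    (fun θ _ ↦ ((hasDerivAt_id θ).div_const 2).sin) (by fun_prop) (by fun_prop)
  rw [neg_div, Real.sin_neg] at h
  rw [← h]
  refine intervalIntegral.integral_congr fun θ _ ↦ ?_
  simp only [Function.comp]
  have h1 : Real.cos θ = 1 - 2 * Real.sin (θ / 2) ^ 2 := by
    rw [Real.sin_sq, show θ = 2 * (θ / 2) by ring, Real.cos_two_mul]
    ring_nf
  rw [← h1, show 3 / 2 * θ = 3 * (θ / 2) by ring, Real.cos_three_mul, Real.sin_sq]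
  ring

lemma exp_gt_mul_sq {t : ℝ} (ht : 10 ≤ t) : 199 * t ^ 2 < Real.exp t := by
  have h1 : (2.718 : ℝ) ^ 10 ≤ Real.exp 1 ^ 10 := by
    gcongr
    linarith [Real.exp_one_gt_d9]
  rw [← Real.exp_nat_mul] at h1
  norm_num at h1
  have h2 := Real.quadratic_le_exp_of_nonneg (x := t - 10) (by linarith)
  have h3 : Real.exp t = Real.exp 10 * Real.exp (t - 10) := by
    rw [← Real.exp_add]; ring_nf
  rw [h3]
  have h4 : 22000 * (1 + (t - 10) + (t - 10) ^ 2 / 2) ≤ Real.exp 10 * Real.exp (t - 10) := by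
    gcongr
    linarith
  nlinarith

set_option maxHeartbeats 1600000 in
/-- The main term of Rademacher's formula approximates `p n`, for large `n`. -/
lemma abs_p_sub_le {n : ℕ} {ρ : ℝ} (hρn : ρ ^ 2 * (24 * n - 1) = 1) (hρ : 0 < ρ)
    (hρ1 : ρ ≤ 1 / 100) :
    |p n - 2 * √3 * ρ ^ 2 * (1 - 6 * ρ / π) * Real.exp (π / (6 * ρ))| ≤
      262 / 100 * ρ ^ 2 * Real.exp (π / (12 * ρ)) + 61 / 50 * Real.exp (π / (18 * ρ)) := by
  obtain ⟨F, hF, hFI⟩ := exists_primitive_partGF n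
  have hpi := Real.pi_pos
  set T := Real.arccos (1 / 3) with hT
  set S := Real.arccos (2 / 3) with hS
  have hcT : Real.cos T = 1 / 3 := Real.cos_arccos (by norm_num) (by norm_num)
  have hcS : Real.cos S = 2 / 3 := Real.cos_arccos (by norm_num) (by norm_num)
  have hsT0 : 0 ≤ Real.sin T := Real.sin_nonneg_of_nonneg_of_le_pi (Real.arccos_nonneg _)
    (Real.arccos_le_pi _)
  have hsS0 : 0 ≤ Real.sin S := Real.sin_nonneg_of_nonneg_of_le_pi (Real.arccos_nonneg _)
    (Real.arccos_le_pi _)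
  have hsT2 : (ρ * Real.sin T) ^ 2 = 8 / 9 * ρ ^ 2 := by
    rw [mul_pow, Real.sin_sq, hcT]; ring
  have hsS2 : (ρ / 2 * Real.sin S) ^ 2 = 5 / 36 * ρ ^ 2 := by
    rw [mul_pow, Real.sin_sq, hcS]; ring
  set s := ρ * Real.sin T with hs
  set t := ρ / 2 * Real.sin S with ht
  have hs0 : 0 ≤ s := by positivity
  have ht0 : 0 ≤ t := by positivity
  have hs1 : s ≤ 1 / 100 := by nlinarith
  have ht1 : t ≤ 1 / 100 := by nlinarith
  have z0 : circleMap 0 ρ (-T) = (ρ / 3 : ℝ) + (-s : ℝ) * Complex.I := by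
    rw [circleMap_re_im, Real.cos_neg, Real.sin_neg, hcT, hs]; push_cast; ring
  have z1 : circleMap 0 ρ T = (ρ / 3 : ℝ) + (s : ℝ) * Complex.I := by
    rw [circleMap_re_im, hcT, hs]; push_cast; ring
  have z2 : circleMap (Complex.I / 2) (ρ / 2) (-S) =
      (ρ / 3 : ℝ) + (1 / 2 - t : ℝ) * Complex.I := by
    rw [circleMap_re_im, Real.cos_neg, Real.sin_neg, hcS, ht]; push_cast; ring
  have z3 : circleMap (Complex.I / 2) (ρ / 2) S =
      (ρ / 3 : ℝ) + (1 / 2 + t : ℝ) * Complex.I := by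
    rw [circleMap_re_im, hcS, ht]; push_cast; ring
  set M := 6 / 5 * Real.exp (π / (18 * ρ)) with hM
  have hM0 : 0 ≤ M := by positivity
  have l1 : ‖F (circleMap (Complex.I / 2) (ρ / 2) (-S)) - F (circleMap 0 ρ T)‖ ≤ M / 2 := by
    rw [z1, z2]
    refine (primitive_sub_le_of_line hF (by positivity) (by linarith) fun z hz h1 h2 ↦
      norm_cauchyInt_le_of_lower hρn hρ hρ1 hs0 hsT2 ht0 hsS2 hz h1 h2).trans ?_
    rw [← hM]
    nlinarith
  have l2 : ‖F ((ρ / 3 : ℝ) + (1 - s : ℝ) * Complex.I) -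
      F (circleMap (Complex.I / 2) (ρ / 2) S)‖ ≤ M / 2 := by
    rw [z3]
    refine (primitive_sub_le_of_line hF (by positivity) (by linarith) fun z hz h1 h2 ↦
      norm_cauchyInt_le_of_upper hρn hρ hρ1 hs0 hsT2 ht0 hsS2 hz h1 h2).trans ?_
    rw [← hM]
    nlinarith
  have a1 := norm_primitive_half_arc_le hF hρn hρ hρ1
  rw [← hS] at a1
  have a0 := norm_primitive_arc_sub_le hF hρn hρ hρ1 hT
  set J := ∫ θ in -T..T, Complex.I * (ρ * √ρ) * (Complex.exp (3 / 2 * θ * Complex.I) *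
    Complex.exp (π / (6 * ρ) * Real.cos θ : ℝ)) with hJ
  have hper : F ((ρ / 3 : ℝ) + (1 - s : ℝ) * Complex.I) = F (circleMap 0 ρ (-T)) +
      Complex.I * p n := by
    rw [← hFI, z0]
    congr 1
    push_cast
    ring
  have hJim : J.im = ρ * √ρ * ∫ θ in -T..T,
      Real.cos (3 / 2 * θ) * Real.exp (π / (6 * ρ) * Real.cos θ) := by
    rw [hJ, ← Complex.imCLM_apply, ← ContinuousLinearMap.intervalIntegral_comp_comm,
      ← intervalIntegral.integral_const_mul]
    · refine intervalIntegral.integral_congr fun θ _ ↦ ?_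
      simp only [Complex.imCLM_apply]
      rw [← Complex.ofReal_exp, show Complex.I * (ρ * √ρ) * (Complex.exp (3 / 2 * θ * Complex.I) *
        (Real.exp (π / (6 * ρ) * Real.cos θ) : ℝ)) =
        ((ρ * √ρ * Real.exp (π / (6 * ρ) * Real.cos θ) : ℝ) : ℂ) *
          (Complex.I * Complex.exp ((3 / 2 * θ : ℝ) * Complex.I)) by push_cast; ring,
        Complex.im_ofReal_mul, Complex.I_mul_im, Complex.exp_ofReal_mul_I_re]
      ring
    · refine Continuous.intervalIntegrable ?_ _ _
      fun_prop
  rw [integral_cos_mul_exp_cos] at hJim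
  have hW2 : Real.sin (T / 2) ^ 2 = 1 / 3 := by
    have h := Real.cos_two_mul (T / 2)
    rw [mul_div_cancel₀ _ two_ne_zero, hcT] at h
    rw [Real.sin_sq]
    linarith
  have hμ : 1 ≤ π / (6 * ρ) := by
    rw [le_div_iff₀ (by positivity)]
    linarith [Real.pi_gt_three]
  have g := integral_gaussian_truncated hμ (W := Real.sin (T / 2))
    (Real.sin_nonneg_of_nonneg_of_le_pi (by linarith [Real.arccos_nonneg (1 / 3)])
      (by linarith [Real.arccos_le_pi (1 / 3)])) hW2
  set G := ∫ w in -Real.sin (T / 2)..Real.sin (T / 2),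
    2 * (1 - 4 * w ^ 2) * Real.exp (π / (6 * ρ) * (1 - 2 * w ^ 2))
  rw [show π / (6 * ρ) / 3 = π / (18 * ρ) by field_simp; norm_num] at g
  have hmain : ρ * √ρ * (2 * (1 - 1 / (π / (6 * ρ))) * √(π / (2 * (π / (6 * ρ)))) *
      Real.exp (π / (6 * ρ))) =
      2 * √3 * ρ ^ 2 * (1 - 6 * ρ / π) * Real.exp (π / (6 * ρ)) := by
    rw [show π / (2 * (π / (6 * ρ))) = 3 * ρ by field_simp; norm_num,
      Real.sqrt_mul (by norm_num), one_div_div]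
    linear_combination (2 * √3 * ρ * (1 - 6 * ρ / π) * Real.exp (π / (6 * ρ))) *
      Real.mul_self_sqrt hρ.le
  have hρρ : ρ * √ρ ≤ 1 / 1000 := by
    have : √ρ ≤ 1 / 10 := by
      rw [Real.sqrt_le_left (by norm_num)]; linarith
    nlinarith [Real.sqrt_nonneg ρ]
  have g' : |J.im - 2 * √3 * ρ ^ 2 * (1 - 6 * ρ / π) * Real.exp (π / (6 * ρ))| ≤
      1 / 100 * Real.exp (π / (18 * ρ)) := by
    rw [hJim, ← hmain, ← mul_sub, abs_mul, abs_of_nonneg (by positivity)]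
    calc _ ≤ 1 / 1000 * (8 * Real.exp (π / (18 * ρ))) := by gcongr
      _ ≤ _ := by linarith [Real.exp_pos (π / (18 * ρ))]
  have htot : |p n - J.im| ≤ 2 * π * (ρ * √ρ) + M +
      262 / 100 * ρ ^ 2 * Real.exp (π / (12 * ρ)) := by
    have e : (Complex.I * p n - J).im = p n - J.im := by simp
    rw [← e]
    refine (Complex.abs_im_le_norm _).trans ?_
    have e2 : Complex.I * p n - J =
        (F (circleMap 0 ρ T) - F (circleMap 0 ρ (-T)) - J) +
        (F (circleMap (Complex.I / 2) (ρ / 2) (-S)) - F (circleMap 0 ρ T)) +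
        (F (circleMap (Complex.I / 2) (ρ / 2) S) - F (circleMap (Complex.I / 2) (ρ / 2) (-S))) +
        (F ((ρ / 3 : ℝ) + (1 - s : ℝ) * Complex.I) - F (circleMap (Complex.I / 2) (ρ / 2) S)) := by
      linear_combination (-1 : ℂ) * hper
    rw [e2]
    refine norm_add₄_le.trans ?_
    linarith
  have h1 : 1 ≤ Real.exp (π / (18 * ρ)) := Real.one_le_exp (by positivity)
  have h2 : 2 * π * (ρ * √ρ) ≤ 2 * 3.15 * (1 / 1000) := by
    gcongr
    exact Real.pi_lt_d2.le
  have h3 := abs_sub_le (p n) J.im (2 * √3 * ρ ^ 2 * (1 - 6 * ρ / π) * Real.exp (π / (6 * ρ)))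
  rw [hM] at htot
  linarith

lemma abs_p_sub_lt_of_large {n : ℕ} (hn : 600 ≤ n) :
    |p n - 2 * √3 / (24 * n - 1) * (1 - 6 / (π * √(24 * n - 1))) *
      Real.exp (π * √(24 * n - 1) / 6)| <
      2 * √3 / (24 * n) * Real.exp (π * √(24 * n) / 12) := by
  have hn' : (600 : ℝ) ≤ n := by exact_mod_cast hn
  set s := √(24 * n - 1 : ℝ) with hs
  have hs2 : s ^ 2 = 24 * n - 1 := Real.sq_sqrt (by linarith)
  have hs0 : 118 ≤ s := Real.le_sqrt_of_sq_le (by linarith)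
  have hpi := Real.pi_pos
  have h := abs_p_sub_le (n := n) (ρ := s⁻¹) (by rw [← hs2]; field_simp) (by positivity)
    (by rw [inv_le_comm₀ (by positivity) (by norm_num)]; linarith)
  have e1 : 2 * √3 * s⁻¹ ^ 2 * (1 - 6 * s⁻¹ / π) * Real.exp (π / (6 * s⁻¹)) =
      2 * √3 / (24 * n - 1) * (1 - 6 / (π * s)) * Real.exp (π * s / 6) := by
    rw [← hs2]
    field_simp
  rw [e1] at h
  refine h.trans_lt ?_
  have h24 : (24 * n : ℝ) = s ^ 2 + 1 := by linarith
  have e2 : π / (12 * s⁻¹) = π * s / 12 := by field_simp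
  have e3 : π / (18 * s⁻¹) = π * s / 18 := by field_simp
  have hle : Real.exp (π * s / 12) ≤ Real.exp (π * √(24 * n) / 12) := by
    gcongr
    exact Real.sqrt_le_sqrt (by linarith)
  rw [e2, e3, h24] at *
  refine lt_of_lt_of_le ?_ (mul_le_mul_of_nonneg_left hle (by positivity))
  have h5 := exp_gt_mul_sq (t := π * s / 36) (by nlinarith [Real.pi_gt_d2])
  have h6 : Real.exp (π * s / 12) = Real.exp (π * s / 18) * Real.exp (π * s / 36) := by
    rw [← Real.exp_add]; ring_nf
  have h7 : (346 / 100 : ℝ) ≤ 2 * √3 := by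
    have : (173 / 100 : ℝ) ≤ √3 := Real.le_sqrt_of_sq_le (by norm_num)
    linarith
  have h8 : 345 / 100 * s⁻¹ ^ 2 ≤ 2 * √3 / (s ^ 2 + 1) := by
    rw [le_div_iff₀ (by positivity), inv_pow]
    field_simp
    nlinarith
  have h9 : 61 / 50 < 83 / 100 * s⁻¹ ^ 2 * Real.exp (π * s / 36) := by
    have h10 : 61 / 50 < 83 / 100 * s⁻¹ ^ 2 * (199 * (π * s / 36) ^ 2) := by
      field_simp
      nlinarith [Real.pi_gt_d2]
    refine h10.trans ?_
    gcongr
  have hE := Real.exp_pos (π * s / 18)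
  have h11 := mul_lt_mul_of_pos_right h9 hE
  calc _ = 262 / 100 * s⁻¹ ^ 2 * Real.exp (π * s / 12) + 61 / 50 * Real.exp (π * s / 18) := rfl
    _ < 262 / 100 * s⁻¹ ^ 2 * Real.exp (π * s / 12) +
        83 / 100 * s⁻¹ ^ 2 * Real.exp (π * s / 36) * Real.exp (π * s / 18) := by linarith
    _ = 345 / 100 * s⁻¹ ^ 2 * Real.exp (π * s / 12) := by rw [h6]; ring
    _ ≤ _ := by gcongr

lemma boundedPart_eq_p {K n : ℕ} (h : n ≤ K) : boundedPart K n = p n := by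
  refine tendsto_nhds_unique ?_ (tendsto_boundedPart n)
  refine tendsto_const_nhds.congr' ?_
  filter_upwards [eventually_ge_atTop K] with L hL
  induction L, hL using Nat.le_induction with
  | base => rfl
  | succ L hL ih => rw [ih, boundedPart_succ, if_neg (by lia), add_zero]

/-- An integer-valued version of `boundedPart`. -/
def boundedPartNat : ℕ → ℕ → ℕ
  | 0, n => if n = 0 then 1 else 0
  | K + 1, n => boundedPartNat K n +
      if K + 1 ≤ n then boundedPartNat (K + 1) (n - (K + 1)) else 0
termination_by K n => (K, n)

lemma cast_boundedPartNat (K n : ℕ) : (boundedPartNat K n : ℝ) = boundedPart K n := by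
  fun_induction boundedPartNat K n with
  | case1 => simp [boundedPart_zero]
  | case2 n h => simp [boundedPart_zero, h]
  | case3 K n ih1 ih2 =>
    rw [boundedPart_succ, Nat.cast_add, ih1, Nat.cast_ite, Nat.cast_zero]
    congr 1
    exact ite_congr rfl ih2 fun _ ↦ rfl

/-- The product `∏ (1 - B ^ k)` for `1 ≤ k ≤ K`, modulo `B ^ M`. -/
def eulerMod (B M : ℕ) : ℕ → ℕ
  | 0 => 1
  | K + 1 => eulerMod B M K * (B ^ M + 1 - B ^ (K + 1)) % B ^ M

lemma sum_boundedPartNat_succ_modEq (B M K : ℕ) :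
    ∑ n ∈ range M, boundedPartNat (K + 1) n * B ^ n ≡
      ∑ n ∈ range M, boundedPartNat K n * B ^ n +
        B ^ (K + 1) * ∑ n ∈ range M, boundedPartNat (K + 1) n * B ^ n [MOD B ^ M] := by
  have h : ∑ n ∈ range M, boundedPartNat (K + 1) n * B ^ n =
      ∑ n ∈ range M, boundedPartNat K n * B ^ n +
        ∑ n ∈ range M, if K + 1 ≤ n then
          boundedPartNat (K + 1) (n - (K + 1)) * B ^ n else 0 := by
    rw [← sum_add_distrib]
    refine sum_congr rfl fun n _ ↦ ?_
    rw [boundedPartNat]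
    split_ifs <;> ring
  nth_rw 1 [h]
  refine Nat.ModEq.add_left _ ?_
  rcases le_total M (K + 1) with hM | hM
  · rw [sum_eq_zero fun n hn ↦ if_neg (by rw [mem_range] at hn; lia)]
    exact ((Nat.modEq_zero_iff_dvd.2 ((pow_dvd_pow B hM).mul_right _))).symm
  · obtain ⟨L, rfl⟩ := Nat.exists_eq_add_of_le hM
    rw [sum_range_add, sum_eq_zero fun n hn ↦ if_neg (by rw [mem_range] at hn; lia), zero_add,
      add_comm (K + 1) L, sum_range_add _ L (K + 1), mul_add, mul_sum, mul_sum]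
    have e1 : ∑ n ∈ range L, (if K + 1 ≤ K + 1 + n then
        boundedPartNat (K + 1) (K + 1 + n - (K + 1)) * B ^ (K + 1 + n) else 0) =
        ∑ n ∈ range L, B ^ (K + 1) * (boundedPartNat (K + 1) n * B ^ n) := by
      refine sum_congr rfl fun n _ ↦ ?_
      rw [if_pos (by lia), Nat.add_sub_cancel_left, pow_add]
      ring
    rw [e1]
    refine (Nat.modEq_zero_iff_dvd.2 (dvd_sum fun n _ ↦ ?_)).symm.add_left _
    exact ⟨boundedPartNat (K + 1) (L + n) * B ^ n, by ring⟩

lemma sum_boundedPartNat_mul_eulerMod {B M : ℕ} (hB : 0 < B) (hM : 0 < M) (K : ℕ) (hK : K ≤ M) :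
    (∑ n ∈ range M, boundedPartNat K n * B ^ n) * eulerMod B M K ≡ 1 [MOD B ^ M] := by
  induction K with
  | zero =>
    rw [sum_eq_single_of_mem 0 (mem_range.2 hM) fun n _ hn ↦ by simp [boundedPartNat, hn]]
    simp [boundedPartNat, eulerMod, Nat.ModEq]
  | succ K ih =>
    refine Nat.ModEq.trans ?_ (ih (by lia))
    set A := ∑ n ∈ range M, boundedPartNat (K + 1) n * B ^ n with hA
    have h := sum_boundedPartNat_succ_modEq B M K
    rw [← hA] at h
    rw [eulerMod]
    refine ((Nat.mod_modEq _ _).mul_left _).trans ?_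
    rw [mul_left_comm, mul_comm (∑ n ∈ range M, boundedPartNat K n * B ^ n)]
    refine Nat.ModEq.mul_left _ ?_
    refine Nat.ModEq.add_right_cancel' (B ^ (K + 1) * A) ?_
    refine Nat.ModEq.trans ?_ h
    have hle : B ^ (K + 1) ≤ B ^ M := Nat.pow_le_pow_right hB hK
    have e : A * (B ^ M + 1 - B ^ (K + 1)) + B ^ (K + 1) * A = A + B ^ M * A := by
      zify [show B ^ (K + 1) ≤ B ^ M + 1 by lia]
      ring
    rw [e]
    exact (Nat.modEq_zero_iff_dvd.2 (dvd_mul_right _ _)).add_left A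

lemma sum_digits_lt {B M : ℕ} {d : ℕ → ℕ} (hd : ∀ n < M, d n < B) :
    ∑ n ∈ range M, d n * B ^ n < B ^ M := by
  induction M with
  | zero => simp
  | succ M ih =>
    rw [sum_range_succ, pow_succ]
    have := ih fun n hn ↦ hd n (by lia)
    have h2 : (d M + 1) * B ^ M ≤ B * B ^ M := Nat.mul_le_mul_right _ (hd M (by lia))
    lia

lemma sum_digits_div_mod {B M : ℕ} {d : ℕ → ℕ} (hd : ∀ n < M, d n < B) {n : ℕ} (hn : n < M) :
    (∑ n ∈ range M, d n * B ^ n) / B ^ n % B = d n := by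
  obtain ⟨L, rfl⟩ := Nat.exists_eq_add_of_lt hn
  have h := sum_digits_lt (M := n) fun k hk ↦ hd k (by lia)
  have hB : 0 < B := (Nat.zero_le _).trans_lt (hd n (by lia))
  have e : ∑ k ∈ range (n + L + 1), d k * B ^ k =
      ∑ k ∈ range n, d k * B ^ k +
        B ^ n * (d n + B * ∑ k ∈ range L, d (n + 1 + k) * B ^ k) := by
    rw [show n + L + 1 = n + 1 + L by ring, sum_range_add, sum_range_succ, mul_add, mul_sum,
      mul_sum, add_assoc, mul_comm (d n)]
    congr 2
    refine sum_congr rfl fun k _ ↦ ?_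
    ring
  rw [e, Nat.add_mul_div_left _ _ (by positivity), Nat.div_eq_of_lt h, zero_add,
    Nat.add_mul_mod_self_left, Nat.mod_eq_of_lt (hd n (by lia))]

/-- The packed partition numbers are determined by inverting the Euler product. -/
lemma p_eq_digit {B M A : ℕ} (hM : 0 < M) (hB : B = 2 ^ M) (hA : A < B ^ M)
    (h : A * eulerMod B M M % B ^ M = 1) {n : ℕ} (hn : n < M) :
    p n = (A / B ^ n % B : ℕ) := by
  have hB0 : 0 < B := by rw [hB]; positivity
  have hd (n : ℕ) (hn : n < M) : boundedPartNat M n < B := by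
    have h1 : p n ≤ 2 ^ n := by
      cases n with
      | zero => simp [p_zero]
      | succ n => exact (p_le_two_pow n).trans (by gcongr <;> norm_num)
    rw [← boundedPart_eq_p (K := M) hn.le, ← cast_boundedPartNat] at h1
    have h2 : boundedPartNat M n ≤ 2 ^ n := by exact_mod_cast h1
    rw [hB]
    exact h2.trans_lt (Nat.pow_lt_pow_right (by norm_num) hn)
  have h1 := sum_boundedPartNat_mul_eulerMod hB0 hM M le_rfl
  set D := ∑ n ∈ range M, boundedPartNat M n * B ^ n with hD
  have h2 : A * eulerMod B M M ≡ 1 [MOD B ^ M] := by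
    rw [Nat.ModEq, h, Nat.mod_eq_of_lt]
    exact Nat.one_lt_pow hM.ne' (by rw [hB]; exact Nat.one_lt_two_pow hM.ne')
  have h3 : A ≡ D [MOD B ^ M] := by
    calc A = A * 1 := (mul_one A).symm
      _ ≡ A * (D * eulerMod B M M) [MOD B ^ M] := h1.symm.mul_left A
      _ = A * eulerMod B M M * D := by ring
      _ ≡ 1 * D [MOD B ^ M] := h2.mul_right D
      _ = D := one_mul D
  have h4 : A = D := h3.eq_of_lt_of_lt hA (sum_digits_lt hd)
  rw [h4, sum_digits_div_mod hd hn, cast_boundedPartNat, boundedPart_eq_p hn.le]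

/-- Newton iteration for the inverse of `E` modulo `Q`. -/
def inverseMod (E Q : ℕ) : ℕ → ℕ
  | 0 => 1
  | k + 1 => inverseMod E Q k * (Q + 2 - E * inverseMod E Q k % Q) % Q

/-- The numbers `p n` for `n < 600`, packed in base `2 ^ 600`. -/
def packedPartitions : ℕ :=
  inverseMod (eulerMod (2 ^ 600) 600 600) ((2 ^ 600) ^ 600) 10

set_option exponentiation.threshold 400000 in
lemma packedPartitions_mul_eulerMod :
    packedPartitions * eulerMod (2 ^ 600) 600 600 % (2 ^ 600) ^ 600 = 1 := by
  decide +kernel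

lemma cast_le_div_add_one (a b : ℕ) : (a : ℝ) / b ≤ (a / b : ℕ) + 1 := by
  rw [← Nat.floor_div_eq_div (K := ℝ)]
  exact (Nat.lt_floor_add_one _).le

/-- `S ^ k * k !` times the partial sum of the exponential series at `a / S`. -/
def expNumerator (a S : ℕ) : ℕ → ℕ
  | 0 => 1
  | k + 1 => expNumerator a S k * (S * (k + 1)) + a ^ (k + 1)

lemma expNumerator_div (a : ℕ) {S : ℕ} (hS : 0 < S) (k : ℕ) :
    (expNumerator a S k : ℝ) / (S ^ k * k.factorial : ℕ) =
      ∑ m ∈ range (k + 1), (a / S : ℝ) ^ m / m.factorial := by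
  induction k with
  | zero => simp [expNumerator]
  | succ k ih =>
    rw [sum_range_succ, ← ih, expNumerator, Nat.factorial_succ, div_pow]
    push_cast
    field_simp
    ring

/-- A fixed-point value of `exp (a / S)`, rounded down. -/
def expFloor (a S : ℕ) : ℕ :=
  expNumerator a S 29 * S / (S ^ 29 * Nat.factorial 29)

lemma expFloor_le {a S : ℕ} (hS : 0 < S) : (expFloor a S : ℝ) ≤ S * Real.exp (a / S) := by
  refine (Nat.cast_div_le).trans ?_
  rw [Nat.cast_mul, mul_comm _ (S : ℝ), mul_div_assoc, expNumerator_div a hS]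
  gcongr
  exact Real.sum_le_exp_of_nonneg (by positivity) _

lemma le_expFloor_add_two {a S : ℕ} (hS : 0 < S) (ha : a ≤ S) (hS2 : S ≤ 10 ^ 30) :
    S * Real.exp (a / S) ≤ expFloor a S + 2 := by
  have h1 : (a / S : ℝ) ≤ 1 := (div_le_one (by positivity)).2 (by exact_mod_cast ha)
  have h := Real.exp_bound' (x := a / S) (by positivity) h1 (n := 30) (by norm_num)
  have h2 : (a / S : ℝ) ^ 30 ≤ 1 := pow_le_one₀ (by positivity) h1
  rw [show (30 : ℕ) = 29 + 1 by rfl, ← expNumerator_div a hS] at h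
  have h3 := cast_le_div_add_one (expNumerator a S 29 * S) (S ^ 29 * Nat.factorial 29)
  rw [Nat.cast_mul, mul_comm _ (S : ℝ), mul_div_assoc] at h3
  have h4 : (a / S : ℝ) ^ 30 * ((30 : ℕ) + 1) / (Nat.factorial 30 * (30 : ℕ)) ≤ 1 / 10 ^ 30 := by
    have : (Nat.factorial 30 : ℝ) = 265252859812191058636308480000000 := by
      norm_num [Nat.factorial]
    rw [this]
    norm_num
    linarith
  have h5 : (S : ℝ) * (1 / 10 ^ 30) ≤ 1 := by
    have : (S : ℝ) ≤ 10 ^ 30 := by exact_mod_cast hS2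
    linarith
  calc _ ≤ (S : ℝ) * (expNumerator a S 29 / (S ^ 29 * Nat.factorial 29 : ℕ) + 1 / 10 ^ 30) := by
        gcongr
        exact h.trans (by gcongr)
    _ ≤ _ := by
        rw [expFloor]
        linarith

/-- Fixed-point squaring, rounded down, iterated. -/
def sqFloor (S : ℕ) : ℕ → ℕ → ℕ
  | 0, x => x
  | k + 1, x => sqFloor S k (x * x / S)

/-- Fixed-point squaring, rounded up, iterated. -/
def sqCeil (S : ℕ) : ℕ → ℕ → ℕ
  | 0, x => x
  | k + 1, x => sqCeil S k (x * x / S + 1)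

lemma sqFloor_le {S : ℕ} (hS : 0 < S) (k x : ℕ) {u : ℝ} (hx : x ≤ S * Real.exp u) :
    sqFloor S k x ≤ S * Real.exp (2 ^ k * u) := by
  induction k generalizing x u with
  | zero => simpa [sqFloor] using hx
  | succ k ih =>
    rw [sqFloor, pow_succ, mul_assoc]
    refine ih _ ((Nat.cast_div_le).trans ?_)
    rw [div_le_iff₀ (by positivity), Nat.cast_mul]
    calc (x * x : ℝ) ≤ (S * Real.exp u) * (S * Real.exp u) := by gcongr
      _ = _ := by rw [two_mul, Real.exp_add]; ring

lemma le_sqCeil {S : ℕ} (hS : 0 < S) (k x : ℕ) {u : ℝ} (hx : S * Real.exp u ≤ x) :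
    S * Real.exp (2 ^ k * u) ≤ sqCeil S k x := by
  induction k generalizing x u with
  | zero => simpa [sqCeil] using hx
  | succ k ih =>
    rw [sqCeil, pow_succ, mul_assoc]
    refine ih _ ?_
    rw [Nat.cast_add, Nat.cast_one]
    refine le_trans ?_ (cast_le_div_add_one _ _)
    rw [le_div_iff₀ (by positivity), Nat.cast_mul]
    calc _ = (S * Real.exp u) * (S * Real.exp u) := by rw [two_mul, Real.exp_add]; ring
      _ ≤ (x * x : ℝ) := by gcongr

/-- Newton iteration for an integer square root. -/
def newtonSqrt (A : ℕ) : ℕ → ℕ → ℕ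
  | 0, x => x
  | k + 1, x => newtonSqrt A k ((x + A / x) / 2)

/-- A check, in fixed-point arithmetic, that `P` is close to the main term of the formula for
`p n`. -/
def mainTermCheck (S n P : ℕ) : Bool :=
  let s := newtonSqrt ((24 * n - 1) * S ^ 2) 40 (130 * S)
  let r := newtonSqrt (3 * S ^ 2) 40 (2 * S)
  let a := 314159265358979323846 * s / (384 * 10 ^ 20)
  let b := 314159265358979323847 * (s + 1) / (384 * 10 ^ 20) + 1
  let v := sqFloor S 5 (expFloor a S)
  let w := sqCeil S 5 (expFloor b S + 2)
  decide (s ^ 2 ≤ (24 * n - 1) * S ^ 2) && decide ((24 * n - 1) * S ^ 2 ≤ (s + 1) ^ 2) &&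
  decide (r ^ 2 ≤ 3 * S ^ 2) && decide (3 * S ^ 2 ≤ (r + 1) ^ 2) &&
  decide (S ≤ 64 * a) && decide (b ≤ S) &&
  decide (P * S ^ 3 * (64 * a) * (24 * n - 1) * (24 * n) <
    2 * r * ((64 * a - S) * v ^ 2 * (24 * n) + v * S * (64 * a) * (24 * n - 1))) &&
  decide (2 * (r + 1) * (64 * b - S) * w ^ 2 * (24 * n) <
    P * S ^ 3 * (64 * b) * (24 * n - 1) * (24 * n) + 2 * r * v * S * (64 * b) * (24 * n - 1))

/-- Run `mainTermCheck` for the digits of `A` in base `B`. -/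
def mainTermCheckAll (S A B : ℕ) : ℕ → Bool
  | 0 => true
  | n + 1 => mainTermCheck S (n + 1) (A / B ^ (n + 1) % B) && mainTermCheckAll S A B n

set_option exponentiation.threshold 400000 in
set_option maxRecDepth 100000 in
lemma mainTermCheckAll_packedPartitions :
    mainTermCheckAll (10 ^ 30) packedPartitions (2 ^ 600) 599 = true := by
  decide +kernel

lemma abs_sub_lt_of_bounds {P m y yl yu w wl wu r rl ru : ℝ} (hm : 1 < m)
    (hyl : 1 ≤ yl) (hy1 : yl ≤ y) (hy2 : y ≤ yu) (hwl : 0 ≤ wl) (hw1 : wl ≤ w) (hw2 : w ≤ wu)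
    (hrl : 0 ≤ rl) (hr1 : rl ≤ r) (hr2 : r ≤ ru)
    (h1 : P < 2 * rl * ((1 - 1 / yl) * wl ^ 2 / (m - 1) + wl / m))
    (h2 : 2 * ru * (1 - 1 / yu) * wu ^ 2 / (m - 1) < P + 2 * rl * wl / m) :
    |P - 2 * r / (m - 1) * (1 - 1 / y) * w ^ 2| < 2 * r / m * w := by
  have hm1 : 0 < m - 1 := by linarith
  have hy0 : 0 < yl := by linarith
  have e1 : 1 - 1 / yl ≤ 1 - 1 / y := by gcongr
  have e2 : 1 - 1 / y ≤ 1 - 1 / yu := by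
    have : 0 < y := by linarith
    gcongr
  have e0 : 0 ≤ 1 - 1 / yl := by
    rw [sub_nonneg, div_le_one hy0]
    exact hyl
  have e3 : 0 ≤ 1 - 1 / y := e0.trans e1
  have hr0 : 0 ≤ r := hrl.trans hr1
  have hw0 : 0 ≤ w := hwl.trans hw1
  have e4 : 0 ≤ 1 - 1 / yu := e3.trans e2
  have hru : 0 ≤ ru := hr0.trans hr2
  rw [abs_lt]
  constructor
  · have a1 : 2 * r * (1 - 1 / y) * w ^ 2 / (m - 1) ≤ 2 * ru * (1 - 1 / yu) * wu ^ 2 / (m - 1) := by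
      gcongr
    have a2 : 2 * rl * wl / m ≤ 2 * r * w / m := by gcongr
    have a3 : 2 * r / (m - 1) * (1 - 1 / y) * w ^ 2 = 2 * r * (1 - 1 / y) * w ^ 2 / (m - 1) := by
      ring
    have a4 : 2 * r / m * w = 2 * r * w / m := by ring
    linarith
  · have a1 : 2 * rl * ((1 - 1 / yl) * wl ^ 2 / (m - 1) + wl / m) ≤
        2 * r * ((1 - 1 / y) * w ^ 2 / (m - 1) + w / m) := by
      gcongr
    have a3 : 2 * r * ((1 - 1 / y) * w ^ 2 / (m - 1) + w / m) =
        2 * r / (m - 1) * (1 - 1 / y) * w ^ 2 + 2 * r / m * w := by ring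
    linarith

lemma abs_sub_lt_of_mainTermCheck {S n P : ℕ} (hS : 0 < S) (hS2 : S ≤ 10 ^ 30) (hn : 1 ≤ n)
    (h : mainTermCheck S n P = true) :
    |(P : ℝ) - 2 * √3 / (24 * n - 1) * (1 - 6 / (π * √(24 * n - 1))) *
      Real.exp (π * √(24 * n - 1) / 6)| <
      2 * √3 / (24 * n) * Real.exp (π * √(24 * n) / 12) := by
  unfold mainTermCheck at h
  extract_lets s r a b v w at h
  simp only [Bool.and_eq_true, decide_eq_true_eq] at h
  obtain ⟨⟨⟨⟨⟨⟨⟨h1, h2⟩, h3⟩, h4⟩, h5⟩, h6⟩, h7⟩, h8⟩ := h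
  have hn' : (1 : ℝ) ≤ n := by exact_mod_cast hn
  have hS' : (0 : ℝ) < S := by exact_mod_cast hS
  have hm : ((24 * n - 1 : ℕ) : ℝ) = 24 * n - 1 := by
    rw [Nat.cast_sub (by lia)]; push_cast; ring
  have hs1 : (s / S : ℝ) ≤ √(24 * n - 1) := by
    apply Real.le_sqrt_of_sq_le
    rw [div_pow, div_le_iff₀ (by positivity), ← hm]
    exact_mod_cast h1
  have hs2 : √(24 * n - 1 : ℝ) ≤ (s + 1) / S := by
    apply Real.sqrt_le_iff.2 ⟨by positivity, ?_⟩
    rw [div_pow, le_div_iff₀ (by positivity), ← hm]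
    exact_mod_cast h2
  have hr1 : (r / S : ℝ) ≤ √3 := by
    apply Real.le_sqrt_of_sq_le
    rw [div_pow, div_le_iff₀ (by positivity)]
    exact_mod_cast h3
  have hr2 : √(3 : ℝ) ≤ (r + 1) / S := by
    apply Real.sqrt_le_iff.2 ⟨by positivity, ?_⟩
    rw [div_pow, le_div_iff₀ (by positivity)]
    exact_mod_cast h4
  set q := √(24 * n - 1 : ℝ) with hq
  have hq0 : 0 < q := Real.sqrt_pos.2 (by linarith)
  have hpi := Real.pi_pos
  set u := π * q / 384 with hu
  have ha : (a / S : ℝ) ≤ u := by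
    rw [div_le_iff₀ hS']
    refine (Nat.cast_div_le).trans ?_
    rw [div_le_iff₀ (by norm_num)]
    rw [div_le_iff₀ hS'] at hs1
    push_cast
    have := Real.pi_gt_d20
    calc (314159265358979323846 * s : ℝ) ≤ (π * 10 ^ 20) * (q * S) := by
          gcongr
          linarith
      _ = _ := by rw [hu]; ring
  have hb : u ≤ (b / S : ℝ) := by
    rw [le_div_iff₀ hS']
    have := cast_le_div_add_one (314159265358979323847 * (s + 1)) (384 * 10 ^ 20)
    rw [Nat.cast_add, Nat.cast_one]
    refine le_trans ?_ this
    rw [le_div_iff₀ (by norm_num)]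
    rw [le_div_iff₀ hS'] at hs2
    push_cast
    have := Real.pi_lt_d20
    calc _ = (π * 10 ^ 20) * (q * S) := by rw [hu]; ring
      _ ≤ (314159265358979323847 * (s + 1) : ℝ) := by
          gcongr
          linarith
  have hv : (v / S : ℝ) ≤ Real.exp (2 ^ 5 * u) := by
    rw [div_le_iff₀ hS', mul_comm]
    refine sqFloor_le hS 5 _ ((expFloor_le hS).trans ?_)
    gcongr
  have hw : Real.exp (2 ^ 5 * u) ≤ (w / S : ℝ) := by
    rw [le_div_iff₀ hS', mul_comm]
    refine le_sqCeil hS 5 _ ?_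
    push_cast
    refine le_trans ?_ (le_expFloor_add_two hS h6 hS2)
    gcongr
  have h5' : (1 : ℝ) ≤ 64 * (a / S) := by
    rw [← mul_div_assoc, le_div_iff₀ hS', one_mul]
    exact_mod_cast h5
  have ha0 : (0 : ℝ) < a := by
    by_contra! h0
    have : (a : ℝ) / S ≤ 0 := div_nonpos_of_nonpos_of_nonneg h0 hS'.le
    linarith
  have hab : (a / S : ℝ) ≤ b / S := ha.trans hb
  have hb0 : (0 : ℝ) < b := by
    rw [div_le_div_iff_of_pos_right hS'] at hab
    linarith
  have h5'' : S ≤ 64 * b := by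
    have : (S : ℝ) ≤ (64 * b : ℕ) := by
      have := h5'.trans (mul_le_mul_of_nonneg_left hab (by norm_num))
      rw [← mul_div_assoc, le_div_iff₀ hS', one_mul] at this
      exact_mod_cast this
    exact_mod_cast this
  have hm0 : (0 : ℝ) < 24 * n - 1 := by linarith
  have k7 : (P : ℝ) < 2 * (r / S) * ((1 - 1 / (64 * (a / S))) * (v / S) ^ 2 / (24 * n - 1) +
      (v / S) / (24 * n)) := by
    have h7' : (P * S ^ 3 * (64 * a) * (24 * n - 1) * (24 * n) : ℝ) <
        2 * r * ((64 * a - S) * v ^ 2 * (24 * n) + v * S * (64 * a) * (24 * n - 1)) := by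
      have h7' : ((P * S ^ 3 * (64 * a) * (24 * n - 1 : ℕ) * (24 * n) : ℕ) : ℝ) <
        (2 * r * ((64 * a - S : ℕ) * v ^ 2 * (24 * n) +
          v * S * (64 * a) * (24 * n - 1 : ℕ)) : ℕ) := by exact_mod_cast h7
      push_cast [hm, Nat.cast_sub h5] at h7'
      exact h7'
    have e : 2 * (r / S) * ((1 - 1 / (64 * (a / S))) * (v / S) ^ 2 / (24 * n - 1) +
      (v / S) / (24 * n)) = 2 * r * ((64 * a - S) * v ^ 2 * (24 * n) +
        v * S * (64 * a) * (24 * n - 1)) / (S ^ 3 * (64 * a) * (24 * n - 1) * (24 * n) : ℝ) := by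
      field_simp
    rw [e, lt_div_iff₀ (by positivity)]
    linarith
  have k8 : 2 * ((r + 1) / S) * (1 - 1 / (64 * (b / S))) * (w / S) ^ 2 / (24 * n - 1) <
      (P : ℝ) + 2 * (r / S) * (v / S) / (24 * n) := by
    have h8' : (2 * (r + 1) * (64 * b - S) * w ^ 2 * (24 * n) : ℝ) <
        P * S ^ 3 * (64 * b) * (24 * n - 1) * (24 * n) +
          2 * r * v * S * (64 * b) * (24 * n - 1) := by
      have h8' : ((2 * (r + 1) * (64 * b - S : ℕ) * w ^ 2 * (24 * n) : ℕ) : ℝ) <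
        (P * S ^ 3 * (64 * b) * (24 * n - 1 : ℕ) * (24 * n) +
          2 * r * v * S * (64 * b) * (24 * n - 1 : ℕ) : ℕ) := by exact_mod_cast h8
      push_cast [hm, Nat.cast_sub h5''] at h8'
      exact h8'
    have e : (P : ℝ) + 2 * (r / S) * (v / S) / (24 * n) -
        2 * ((r + 1) / S) * (1 - 1 / (64 * (b / S))) * (w / S) ^ 2 / (24 * n - 1) =
        (P * S ^ 3 * (64 * b) * (24 * n - 1) * (24 * n) +
          2 * r * v * S * (64 * b) * (24 * n - 1) -
          2 * (r + 1) * (64 * b - S) * w ^ 2 * (24 * n)) /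
          (S ^ 3 * (64 * b) * (24 * n - 1) * (24 * n)) := by
      field_simp
    rw [← sub_pos, e]
    exact div_pos (by linarith) (by positivity)
  have key := abs_sub_lt_of_bounds (m := 24 * n) (y := 64 * u) (by linarith) h5' (by gcongr)
    (by gcongr) (by positivity) hv hw (by positivity) hr1 hr2 k7 k8
  have e1 : 1 / (64 * u) = 6 / (π * q) := by rw [hu]; field_simp; norm_num
  have e2 : Real.exp (2 ^ 5 * u) ^ 2 = Real.exp (π * q / 6) := by
    rw [← Real.exp_nat_mul, hu]
    congr 1
    push_cast
    ring
  rw [e1, e2] at key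
  refine key.trans_le ?_
  gcongr
  rw [hu, show 2 ^ 5 * (π * q / 384) = π * q / 12 by ring]
  gcongr
  exact Real.sqrt_le_sqrt (by linarith)

lemma mainTermCheck_of_all {S A B N : ℕ} (h : mainTermCheckAll S A B N = true) {n : ℕ}
    (hn : 1 ≤ n) (hnN : n ≤ N) : mainTermCheck S n (A / B ^ n % B) = true := by
  induction N with
  | zero => lia
  | succ N ih =>
    rw [mainTermCheckAll, Bool.and_eq_true] at h
    rcases hnN.eq_or_lt with rfl | h1
    · exact h.1
    · exact ih h.2 (by lia)

lemma packedPartitions_lt : packedPartitions < (2 ^ 600) ^ 600 := by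
  rw [packedPartitions, inverseMod]
  exact Nat.mod_lt _ (by positivity)

/-- The main term of Rademacher's formula approximates `p n`. -/
lemma abs_p_sub_lt {n : ℕ} (hn : 1 ≤ n) :
    |p n - 2 * √3 / (24 * n - 1) * (1 - 6 / (π * √(24 * n - 1))) *
      Real.exp (π * √(24 * n - 1) / 6)| <
      2 * √3 / (24 * n) * Real.exp (π * √(24 * n) / 12) := by
  rcases le_or_gt 600 n with h | h
  · exact abs_p_sub_lt_of_large h
  · rw [p_eq_digit (by norm_num) rfl packedPartitions_lt packedPartitions_mul_eulerMod h]
    exact abs_sub_lt_of_mainTermCheck (by positivity) le_rfl hn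
      (mainTermCheck_of_all mainTermCheckAll_packedPartitions hn (by lia))

lemma circleIntegral_exp_div_pow (a : ℂ) (j : ℕ) :
    ∮ z in C(0, 1), Complex.exp (a * z) / z ^ (j + 1) =
      2 * π * Complex.I * (a ^ j / j.factorial) := by
  have h := DifferentiableOn.circleIntegral_one_div_sub_center_pow_smul (c := 0) one_pos j
    (f := fun z ↦ Complex.exp (a * z)) (by fun_prop)
  rw [iteratedDeriv_cexp_const_mul] at h
  simp only [sub_zero, smul_eq_mul, mul_zero, Complex.exp_zero, mul_one] at h
  calc _ = ∮ z in C(0, 1), 1 / z ^ (j + 1) * Complex.exp (a * z) := by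
        simp only [one_div_mul_eq_div]
    _ = _ := h
    _ = _ := by ring

lemma circleIntegral_sq_add_one_pow_mul_exp (a : ℂ) (m : ℕ) :
    ∮ z in C(0, 1), (z ^ 2 + 1) ^ m * Complex.exp (a * z) / z ^ (m + 2) =
      2 * π * Complex.I * ∑ k ∈ range ((m + 1) / 2 + 1),
        m.choose k * (a ^ (m + 1 - 2 * k) / (m + 1 - 2 * k).factorial) := by
  have h0 : ∀ z ∈ Metric.sphere (0 : ℂ) 1, z ≠ 0 := fun z hz ↦
    ne_zero_of_mem_unit_sphere (⟨z, hz⟩ : Metric.sphere (0 : ℂ) 1)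
  have h1 : ∮ z in C(0, 1), (z ^ 2 + 1) ^ m * Complex.exp (a * z) / z ^ (m + 2) =
      ∮ z in C(0, 1), ∑ k ∈ range (m + 1),
        (m.choose k : ℂ) * (z ^ (2 * k) * Complex.exp (a * z) / z ^ (m + 2)) := by
    congr 1
    ext z
    rw [add_pow, sum_mul, sum_div]
    refine sum_congr rfl fun k _ ↦ ?_
    rw [one_pow, mul_one, ← pow_mul]
    ring
  rw [h1, circleIntegral.integral_fun_sum]
  swap
  · intro k _
    refine ContinuousOn.circleIntegrable zero_le_one ?_
    refine continuousOn_const.mul (ContinuousOn.div (by fun_prop) (by fun_prop) fun z hz ↦ ?_)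
    exact pow_ne_zero _ (h0 z hz)
  simp only [circleIntegral.integral_const_mul]
  rw [mul_sum, ← sum_subset (s₁ := range ((m + 1) / 2 + 1))]
  · refine sum_congr rfl fun k hk ↦ ?_
    rw [mem_range] at hk
    obtain ⟨j, hj⟩ := Nat.exists_eq_add_of_le (show 2 * k ≤ m + 1 by lia)
    rw [hj, Nat.add_sub_cancel_left, mul_left_comm, ← circleIntegral_exp_div_pow]
    congr 1
    refine circleIntegral.integral_congr zero_le_one fun z hz ↦ ?_
    have := h0 z hz
    rw [show m + 2 = 2 * k + (j + 1) by lia, pow_add]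
    field_simp
  · exact range_subset_range.2 (by lia)
  · intro k _ hk
    rw [mem_range] at hk
    obtain ⟨j, hj⟩ := Nat.exists_eq_add_of_le (show m + 2 ≤ 2 * k by lia)
    have : ∮ z in C(0, 1), z ^ (2 * k) * Complex.exp (a * z) / z ^ (m + 2) =
        ∮ z in C(0, 1), z ^ j * Complex.exp (a * z) := by
      refine circleIntegral.integral_congr zero_le_one fun z hz ↦ ?_
      have := h0 z hz
      rw [hj, pow_add]
      field_simp
    rw [this, Complex.circleIntegral_eq_zero_of_differentiable_on_off_countable zero_le_one
      Set.countable_empty (by fun_prop) (fun z _ ↦ by fun_prop), mul_zero]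

lemma hasSum_circleIntegral_geometric (a : ℂ) {y : ℂ} (hy : ‖y‖ < 1 / 2) :
    HasSum (fun m : ℕ ↦ ∮ z in C(0, 1), (m + 1) * y ^ m *
        ((z ^ 2 + 1) ^ m * Complex.exp (a * z) / z ^ (m + 2)))
      (∮ z in C(0, 1), Complex.exp (a * z) / (z - y * (z ^ 2 + 1)) ^ 2) := by
  have hy2 : 2 * ‖y‖ < 1 := by linarith
  have hn (θ : ℝ) : ‖circleMap 0 1 θ‖ = 1 := by simp
  have h0 (θ : ℝ) : circleMap 0 1 θ ≠ 0 := by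
    rw [← norm_ne_zero_iff, hn]; exact one_ne_zero
  have hsum := hasSum_choose_mul_geometric_of_norm_lt_one (𝕜 := ℝ) 1 (r := 2 * ‖y‖)
    (by rwa [Real.norm_of_nonneg (by positivity)])
  refine intervalIntegral.hasSum_integral_of_dominated_convergence
    (fun m θ ↦ Real.exp ‖a‖ * (((m + 1 : ℕ).choose 1 : ℝ) * (2 * ‖y‖) ^ m))
    (fun m ↦ ?_) (fun m ↦ ?_) ?_ ?_ ?_
  · simp only [deriv_circleMap]
    have hc := continuous_circleMap 0 1
    have hf : Continuous fun θ ↦ (m + 1 : ℂ) * y ^ m * ((circleMap 0 1 θ ^ 2 + 1) ^ m *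
        Complex.exp (a * circleMap 0 1 θ) / circleMap 0 1 θ ^ (m + 2)) :=
      continuous_const.mul (Continuous.div (by fun_prop) (by fun_prop)
        fun θ ↦ pow_ne_zero _ (h0 θ))
    exact ((hc.mul continuous_const).smul hf).aestronglyMeasurable
  · refine Eventually.of_forall fun θ _ ↦ ?_
    rw [norm_smul, deriv_circleMap, norm_mul, norm_mul, norm_mul, norm_div, norm_mul, norm_pow,
      norm_pow, norm_pow, hn, Complex.norm_I]
    have e1 : ‖(circleMap 0 1 θ) ^ 2 + 1‖ ≤ 2 := by
      refine (norm_add_le _ _).trans ?_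
      rw [norm_pow, hn]
      norm_num
    have e2 : ‖Complex.exp (a * circleMap 0 1 θ)‖ ≤ Real.exp ‖a‖ := by
      rw [Complex.norm_exp, Real.exp_le_exp]
      refine (Complex.re_le_norm _).trans ?_
      rw [norm_mul, hn, mul_one]
    have e3 : ‖(m + 1 : ℂ)‖ = m + 1 := by
      rw [← Nat.cast_succ, Complex.norm_natCast, Nat.cast_succ]
    rw [e3, Nat.choose_one_right, one_pow, div_one, one_mul, one_mul, mul_pow]
    calc _ ≤ ((m : ℝ) + 1) * ‖y‖ ^ m * (2 ^ m * Real.exp ‖a‖) := by gcongr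
      _ = _ := by push_cast; ring
  · exact Eventually.of_forall fun θ _ ↦ hsum.summable.mul_left _
  · exact intervalIntegrable_const
  · refine Eventually.of_forall fun θ _ ↦ HasSum.const_smul _ ?_
    set z := circleMap 0 1 θ with hz
    have hz0 : z ≠ 0 := h0 θ
    have hT : ‖y * ((z ^ 2 + 1) / z)‖ < 1 := by
      rw [norm_mul, norm_div, hn, div_one]
      refine lt_of_le_of_lt ?_ hy2
      rw [mul_comm]
      gcongr
      refine (norm_add_le _ _).trans ?_
      rw [norm_pow, hn]
      norm_num
    have h := (hasSum_choose_mul_geometric_of_norm_lt_one 1 hT).mul_left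
      (Complex.exp (a * z) / z ^ 2)
    have hne : z - y * (z ^ 2 + 1) ≠ 0 := by
      intro h1
      rw [sub_eq_zero] at h1
      rw [← mul_div_assoc, ← h1, div_self hz0, norm_one] at hT
      exact lt_irrefl _ hT
    have e : Complex.exp (a * z) / z ^ 2 * (1 / (1 - y * ((z ^ 2 + 1) / z)) ^ (1 + 1)) =
        Complex.exp (a * z) / (z - y * (z ^ 2 + 1)) ^ 2 := by
      rw [show 1 - y * ((z ^ 2 + 1) / z) = (z - y * (z ^ 2 + 1)) / z by field_simp, div_pow,
        one_div_div, div_mul_div_comm, mul_comm (z ^ 2), mul_div_mul_right _ _ (pow_ne_zero 2 hz0)]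
    rw [e] at h
    refine h.congr_fun fun m ↦ ?_
    rw [Nat.choose_one_right, mul_pow, div_pow]
    push_cast
    field_simp
    ring

/-- The generating function, in closed form. -/
lemma hasSum_sum_choose_mul (a u v y : ℂ) (hy : ‖y‖ < 1 / 2) (hu : ‖u‖ < 1) (hv : 1 < ‖v‖)
    (hy0 : y ≠ 0) (huv : u * v = 1) (huv' : y * (u + v) = 1) :
    HasSum (fun m : ℕ ↦ (m + 1) * y ^ m * ∑ k ∈ range ((m + 1) / 2 + 1),
        (m.choose k : ℂ) * (a ^ (m + 1 - 2 * k) / (m + 1 - 2 * k).factorial))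
      (Complex.exp (a * u) / y ^ 2 * (a / (u - v) ^ 2 - 2 / (u - v) ^ 3)) := by
  have hne : u - v ≠ 0 := by
    intro h
    rw [sub_eq_zero] at h
    rw [h] at hu
    linarith
  have h := hasSum_circleIntegral_geometric a hy
  simp only [circleIntegral.integral_const_mul, circleIntegral_sq_add_one_pow_mul_exp] at h
  have hg (w : ℂ) (hw : w ≠ v) : HasDerivAt (fun z ↦ Complex.exp (a * z) / (y * (z - v)) ^ 2)
      (Complex.exp (a * w) / y ^ 2 * (a / (w - v) ^ 2 - 2 / (w - v) ^ 3)) w := by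
    have hw' : w - v ≠ 0 := sub_ne_zero.2 hw
    have h1 := ((hasDerivAt_id w).const_mul a).cexp
    have h2 := (((hasDerivAt_id w).sub_const v).const_mul y).pow 2
    have h3 := h1.div h2 (pow_ne_zero _ (mul_ne_zero hy0 hw'))
    refine h3.congr_deriv ?_
    simp only [id, Pi.pow_apply, Nat.cast_ofNat, Nat.add_one_sub_one, pow_one]
    field_simp
  have hd : DifferentiableOn ℂ (fun z ↦ Complex.exp (a * z) / (y * (z - v)) ^ 2) {v}ᶜ :=
    fun w hw ↦ (hg w hw).differentiableAt.differentiableWithinAt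
  have hC := Complex.two_pi_I_inv_smul_circleIntegral_sub_sq_inv_smul_of_differentiable
    isOpen_compl_singleton (c := 0) (R := 1) (w₀ := u) (fun z hz ↦ by
      rintro rfl
      rw [mem_closedBall_zero_iff] at hz
      linarith) hd (by rwa [mem_ball_zero_iff])
  rw [(hg u (sub_ne_zero.1 hne)).deriv] at hC
  rw [← hC, smul_eq_mul]
  have h2 := h.mul_left (2 * π * Complex.I)⁻¹
  have e (z : ℂ) : ((z - u) ^ 2)⁻¹ • (Complex.exp (a * z) / (y * (z - v)) ^ 2) =
      Complex.exp (a * z) / (z - y * (z ^ 2 + 1)) ^ 2 := by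
    rw [smul_eq_mul, ← div_eq_inv_mul, div_div, ← mul_pow, ← neg_sq (z - y * (z ^ 2 + 1))]
    congr 2
    linear_combination (-z) * huv' + y * huv
  simp only [e]
  refine h2.congr_fun fun m ↦ ?_
  have : 2 * π * Complex.I ≠ 0 := Complex.two_pi_I_ne_zero
  rw [mul_left_comm, inv_mul_cancel_left₀ this]

/-- The coefficient of `w ^ (m + 1)` in `(w ^ 2 + 1) ^ m * exp (a * w)`. -/
noncomputable def chooseExpSum (a : ℝ) (m : ℕ) : ℝ :=
  ∑ k ∈ range ((m + 1) / 2 + 1),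
    (m.choose k : ℝ) * (a ^ (m + 1 - 2 * k) / (m + 1 - 2 * k).factorial)

lemma c_div_rpow (m : ℕ) {n : ℕ} (hn : 1 ≤ n) :
    c m / (n : ℝ) ^ ((m : ℝ) / 2) =
      (-1) ^ m * (6 / π * ((m + 1) * (1 / (2 * √(24 * n))) ^ m * chooseExpSum (π / 6) m)) := by
  have hn' : (0 : ℝ) < n := by exact_mod_cast hn
  have hpi := Real.pi_pos
  have e1 : (n : ℝ) ^ ((m : ℝ) / 2) = √n ^ m := by
    rw [Real.sqrt_eq_rpow, ← Real.rpow_natCast, ← Real.rpow_mul hn'.le]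
    ring_nf
  have e2 : 2 * √(24 * n) = 4 * √6 * √(n : ℝ) := by
    rw [show (24 * n : ℝ) = 2 ^ 2 * (6 * n) by ring, Real.sqrt_mul (by norm_num),
      Real.sqrt_sq (by norm_num), Real.sqrt_mul (by norm_num)]
    ring
  have e3 : ∑ k ∈ Finset.range ((m + 1) / 2 + 1),
      ((m + 1).choose k : ℝ) * ((m + 1 - k : ℕ) : ℝ) / ((m + 1 - 2 * k).factorial : ℝ) *
        (π / 6) ^ ((m : ℤ) - 2 * k) = 6 / π * ((m + 1) * chooseExpSum (π / 6) m) := by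
    rw [chooseExpSum, mul_sum, mul_sum]
    refine sum_congr rfl fun k hk ↦ ?_
    rw [mem_range] at hk
    have h1 : ((m + 1).choose k : ℝ) * ((m + 1 - k : ℕ) : ℝ) = m.choose k * (m + 1) := by
      exact_mod_cast (Nat.choose_mul_succ_eq m k).symm
    have h2 : (π / 6) ^ ((m : ℤ) - 2 * k) = (π / 6) ^ (m + 1 - 2 * k) * (6 / π) := by
      rw [show (m : ℤ) - 2 * k = ((m + 1 - 2 * k : ℕ) : ℤ) - 1 by
        rw [Nat.cast_sub (by lia)]; push_cast; ring, zpow_sub_one₀ (by positivity), zpow_natCast,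
        inv_div]
    rw [h1, h2]
    ring
  rw [c, e3, e1, e2, one_div, inv_pow, mul_pow _ (√(n : ℝ))]
  field_simp

/-- The asymptotic series converges to the main term of the formula for `p n`. -/
lemma hasSum_c_div_rpow {n : ℕ} (hn : 1 ≤ n) :
    HasSum (fun m : ℕ ↦ c m / (n : ℝ) ^ ((m : ℝ) / 2))
      (4 * √3 * n * Real.exp (-(π * √(2 * n / 3))) *
        (2 * √3 / (24 * n - 1) * (1 - 6 / (π * √(24 * n - 1))) *
          Real.exp (π * √(24 * n - 1) / 6))) := by
  have hn' : (1 : ℝ) ≤ n := by exact_mod_cast hn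
  have hpi := Real.pi_pos
  set t := √(24 * n : ℝ) with ht
  set s := √(24 * n - 1 : ℝ) with hs
  have ht2 : t ^ 2 = 24 * n := Real.sq_sqrt (by linarith)
  have hs2 : s ^ 2 = 24 * n - 1 := Real.sq_sqrt (by linarith)
  have ht0 : 0 < t := Real.sqrt_pos.2 (by linarith)
  have hs0 : 0 < s := Real.sqrt_pos.2 (by linarith)
  have hts : t ^ 2 = s ^ 2 + 1 := by rw [ht2, hs2]; ring
  have hst : s < t := by nlinarith
  have ht4 : 4 < t := Real.lt_sqrt_of_sq_lt (by linarith)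
  have e1 : √(2 * n / 3 : ℝ) = t / 6 := by
    rw [Real.sqrt_eq_iff_mul_self_eq (by positivity) (by positivity)]
    linear_combination (-1 / 36 : ℝ) * ht2
  have hu0 : 0 < t - s := by linarith
  have huv : (s - t) * (-(t + s)) = 1 := by linear_combination hts
  have hu1 : t - s < 1 := by nlinarith
  have h := hasSum_sum_choose_mul ((π / 6 : ℝ) : ℂ) ((s - t : ℝ) : ℂ) ((-(t + s) : ℝ) : ℂ)
    ((-(1 / (2 * t)) : ℝ) : ℂ)
    (by
      rw [Complex.norm_real, Real.norm_eq_abs, abs_neg, abs_of_pos (by positivity)]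
      gcongr
      linarith)
    (by
      rw [Complex.norm_real, Real.norm_eq_abs, abs_sub_comm, abs_of_pos hu0]
      exact hu1)
    (by
      rw [Complex.norm_real, Real.norm_eq_abs, abs_neg, abs_of_pos (by positivity)]
      linarith)
    (by
      rw [Complex.ofReal_ne_zero, neg_ne_zero]
      positivity)
    (by exact_mod_cast huv)
    (by
      rw [← Complex.ofReal_add, ← Complex.ofReal_mul]
      norm_cast
      field_simp
      ring)
  have h2 := (Complex.hasSum_ofReal (f := fun m : ℕ ↦
    (m + 1) * (-(1 / (2 * t))) ^ m * chooseExpSum (π / 6) m)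
    (x := Real.exp (π / 6 * (s - t)) / (-(1 / (2 * t))) ^ 2 *
      (π / 6 / (s - t - -(t + s)) ^ 2 - 2 / (s - t - -(t + s)) ^ 3))).1 (by
    push_cast [chooseExpSum] at h ⊢
    exact h)
  have h3 := h2.mul_left (6 / π)
  have e2 : 6 / π * (Real.exp (π / 6 * (s - t)) / (-(1 / (2 * t))) ^ 2 *
      (π / 6 / (s - t - -(t + s)) ^ 2 - 2 / (s - t - -(t + s)) ^ 3)) =
      4 * √3 * n * Real.exp (-(π * √(2 * n / 3))) *
        (2 * √3 / (24 * n - 1) * (1 - 6 / (π * s)) * Real.exp (π * s / 6)) := by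
    rw [show π / 6 * (s - t) = -(π * (t / 6)) + π * s / 6 by ring, Real.exp_add, e1, ← hs2,
      show (n : ℝ) = t ^ 2 / 24 by linarith, show s - t - -(t + s) = 2 * s by ring]
    have h33 : √3 * √3 = (3 : ℝ) := Real.mul_self_sqrt (by norm_num)
    generalize Real.exp (-(π * (t / 6))) = E
    generalize Real.exp (π * s / 6) = F
    rw [show 4 * √3 * (t ^ 2 / 24) * E * (2 * √3 / s ^ 2 * (1 - 6 / (π * s)) * F) =
      √3 * √3 * (4 * (t ^ 2 / 24) * E * (2 / s ^ 2 * (1 - 6 / (π * s)) * F)) by ring, h33]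
    field_simp
    ring
  rw [e2] at h3
  refine (congrArg (HasSum · _) (funext fun m ↦ ?_)).mpr h3
  rw [c_div_rpow m hn, ← ht, show (-(1 / (2 * t))) ^ m = (-1) ^ m * (1 / (2 * t)) ^ m from
    neg_pow _ _]
  ring

lemma chooseExpSum_nonneg {a : ℝ} (ha : 0 ≤ a) (m : ℕ) : 0 ≤ chooseExpSum a m := by
  unfold chooseExpSum
  positivity

lemma choose_succ_le_two_mul_choose {m k : ℕ} (hk : 2 * k ≤ m + 1) :
    (m + 1).choose k ≤ 2 * m.choose k := by
  rcases k with _ | k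
  · simp
  · have h := Nat.choose_succ_right_eq m k
    have h2 : m.choose k ≤ m.choose (k + 1) := by
      have h3 : m.choose k * (k + 1) ≤ m.choose (k + 1) * (k + 1) := by
        rw [h]
        gcongr
        lia
      exact Nat.le_of_mul_le_mul_right h3 k.succ_pos
    rw [Nat.choose_succ_succ]
    lia

lemma chooseExpSum_succ_le {a : ℝ} (ha : 0 < a) (m : ℕ) :
    chooseExpSum a (m + 1) ≤ (2 * a + 2 / a) * chooseExpSum a m := by
  have key : ∑ k ∈ range ((m + 1) / 2 + 1),
      ((m + 1).choose k : ℝ) * (a ^ (m + 1 + 1 - 2 * k) / (m + 1 + 1 - 2 * k).factorial) ≤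
        2 * a * chooseExpSum a m := by
    rw [chooseExpSum, mul_sum]
    refine sum_le_sum fun k hk ↦ ?_
    rw [mem_range] at hk
    obtain ⟨j, hj⟩ : ∃ j, m + 1 - 2 * k = j := ⟨_, rfl⟩
    rw [show m + 1 + 1 - 2 * k = j + 1 by lia, hj]
    have h1 : ((m + 1).choose k : ℝ) ≤ 2 * m.choose k := by
      exact_mod_cast choose_succ_le_two_mul_choose (by lia)
    have h2 : a ^ (j + 1) / (j + 1).factorial ≤ a * (a ^ j / j.factorial) := by
      rw [pow_succ', mul_div_assoc]
      gcongr
      lia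
    calc _ ≤ (2 * m.choose k) * (a * (a ^ j / j.factorial)) := by gcongr
      _ = _ := by ring
  have h0 := chooseExpSum_nonneg ha.le m
  rcases Nat.even_or_odd' m with ⟨l, rfl | rfl⟩
  · have h1 : ((2 * l + 1).choose (l + 1) : ℝ) ≤ 2 / a * chooseExpSum a (2 * l) := by
      have h2 : ((2 * l).choose l : ℝ) * (a ^ (2 * l + 1 - 2 * l) / (2 * l + 1 - 2 * l).factorial) ≤
          chooseExpSum a (2 * l) :=
        single_le_sum (f := fun k ↦ ((2 * l).choose k : ℝ) *
          (a ^ (2 * l + 1 - 2 * k) / (2 * l + 1 - 2 * k).factorial))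
          (fun i _ ↦ by positivity) (mem_range.2 (by lia))
      rw [show 2 * l + 1 - 2 * l = 1 by lia] at h2
      have h3 : ((2 * l + 1).choose (l + 1) : ℝ) ≤ 2 * (2 * l).choose l := by
        rw [Nat.choose_symm_half]
        exact_mod_cast choose_succ_le_two_mul_choose (by lia)
      refine h3.trans ?_
      rw [div_mul_eq_mul_div, le_div_iff₀ ha]
      norm_num at h2
      linarith
    rw [chooseExpSum, show (2 * l + 1 + 1) / 2 + 1 = (2 * l + 1) / 2 + 1 + 1 by lia,
      sum_range_succ, show (2 * l + 1) / 2 + 1 = l + 1 by lia]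
    rw [show (2 * l + 1) / 2 + 1 = l + 1 by lia] at key
    rw [show 2 * l + 1 + 1 - 2 * (l + 1) = 0 by lia]
    norm_num at key h1 ⊢
    linarith
  · rw [chooseExpSum, show (2 * l + 1 + 1 + 1) / 2 + 1 = (2 * l + 1 + 1) / 2 + 1 by lia]
    have : 0 ≤ 2 / a * chooseExpSum a (2 * l + 1) := by positivity
    linarith

lemma chooseExpSum_two_mul_le {a : ℝ} (ha : 0 ≤ a) (N : ℕ) :
    chooseExpSum a (2 * N) ≤ N.centralBinom * Real.sinh a := by
  have h1 : ∑ j ∈ range (N + 1), a ^ (2 * j + 1) / (2 * j + 1).factorial ≤ Real.sinh a :=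
    sum_le_hasSum _ (fun _ _ ↦ by positivity) (Real.hasSum_sinh a)
  calc chooseExpSum a (2 * N)
      = ∑ k ∈ range (N + 1), ((2 * N).choose k : ℝ) *
          (a ^ (2 * (N - k) + 1) / (2 * (N - k) + 1).factorial) := by
        rw [chooseExpSum, show (2 * N + 1) / 2 + 1 = N + 1 by lia]
        refine sum_congr rfl fun k hk ↦ ?_
        rw [mem_range] at hk
        rw [show 2 * N + 1 - 2 * k = 2 * (N - k) + 1 by lia]
    _ ≤ ∑ k ∈ range (N + 1), (N.centralBinom : ℝ) *
          (a ^ (2 * (N - k) + 1) / (2 * (N - k) + 1).factorial) := by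
        gcongr with k hk
        exact Nat.choose_le_centralBinom k N
    _ = N.centralBinom * ∑ j ∈ range (N + 1), a ^ (2 * j + 1) / (2 * j + 1).factorial := by
        rw [← mul_sum]
        congr 1
        rw [← sum_range_reflect (fun j ↦ a ^ (2 * j + 1) / ((2 * j + 1).factorial : ℝ))]
        refine sum_congr rfl fun k hk ↦ ?_
        rw [mem_range] at hk
        rw [show N + 1 - 1 - k = N - k by lia]
    _ ≤ _ := by gcongr

/-- A sharp form of the upper bound for the central binomial coefficient. -/
lemma centralBinom_le_four_pow_mul_sqrt (N : ℕ) :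
    (N.centralBinom : ℝ) ≤ 4 ^ N * √(4 / (π * (4 * N + 1))) := by
  have hpi := Real.pi_pos
  have hmono : Monotone fun k : ℕ ↦ (4 * k + 1 : ℝ) / ((2 * k + 1) * Wallis.W k) := by
    refine monotone_nat_of_le_succ fun k ↦ ?_
    have hW := Wallis.W_pos k
    rw [Wallis.W_succ, div_le_div_iff₀ (by positivity) (by positivity)]
    push_cast
    have h1 : (0 : ℝ) < 2 * k + 1 := by positivity
    have h2 : (0 : ℝ) < 2 * k + 3 := by positivity
    field_simp
    nlinarith
  have hlim : Tendsto (fun k : ℕ ↦ (4 * k + 1 : ℝ) / ((2 * k + 1) * Wallis.W k)) atTop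
      (𝓝 (2 / (π / 2))) := by
    have h1 : Tendsto (fun k : ℕ ↦ (2 : ℝ) - 1 / (2 * k + 1)) atTop (𝓝 (2 - 0)) := by
      refine tendsto_const_nhds.sub (tendsto_const_nhds.div_atTop ?_)
      exact tendsto_atTop_add_const_right _ _
        (tendsto_natCast_atTop_atTop.const_mul_atTop (by norm_num))
    rw [sub_zero] at h1
    refine (h1.div Wallis.tendsto_W_nhds_pi_div_two (by positivity)).congr fun k ↦ ?_
    have hW := Wallis.W_pos k
    simp only [Pi.div_apply]
    field_simp
    ring
  have hle := hmono.ge_of_tendsto hlim N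
  have hW := Wallis.W_pos N
  have hC : (N.centralBinom : ℝ) ^ 2 * ((2 * N + 1) * Wallis.W N) = 16 ^ N := by
    have h1 : (N.centralBinom : ℝ) * N.factorial ^ 2 = (2 * N).factorial := by
      have := Nat.choose_mul_factorial_mul_factorial (show N ≤ 2 * N by lia)
      rw [show 2 * N - N = N by lia] at this
      rw [Nat.centralBinom_eq_two_mul_choose]
      rw [pow_two, ← mul_assoc]
      exact_mod_cast this
    rw [Wallis.W_eq_factorial_ratio, ← h1, show (16 : ℝ) = 2 ^ 4 by norm_num, ← pow_mul]
    have : (N.centralBinom : ℝ) ≠ 0 := by exact_mod_cast N.centralBinom_ne_zero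
    field_simp
  have hD : 0 < (2 * N + 1) * Wallis.W N := by positivity
  have h1 : 1 ≤ (2 * N + 1) * Wallis.W N * (4 / (π * (4 * N + 1))) := by
    rw [div_le_div_iff₀ hD (by positivity)] at hle
    rw [← mul_div_assoc, one_le_div (by positivity)]
    linarith
  refine (sq_le_sq₀ (by positivity) (by positivity)).1 ?_
  rw [mul_pow, Real.sq_sqrt (by positivity), ← pow_mul, mul_comm N, pow_mul,
    show (4 : ℝ) ^ 2 = 16 by norm_num, ← hC, mul_assoc]
  exact le_mul_of_one_le_right (by positivity) h1

/-- The terms of the asymptotic series decrease in absolute value. -/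
lemma antitone_term {n : ℕ} (hn : 1 ≤ n) : Antitone fun m : ℕ ↦
    6 / π * ((m + 1) * (1 / (2 * √(24 * n))) ^ m * chooseExpSum (π / 6) m) := by
  have hn' : (1 : ℝ) ≤ n := by exact_mod_cast hn
  have hpi := Real.pi_pos
  have hpi1 := Real.pi_gt_d2
  have hpi2 := Real.pi_lt_d2
  have ht : 4.88 ≤ √(24 * n : ℝ) := Real.le_sqrt_of_sq_le (by linarith)
  refine antitone_nat_of_succ_le fun m ↦ ?_
  have hQ := chooseExpSum_nonneg (show 0 ≤ π / 6 by positivity) m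
  have hQs := chooseExpSum_nonneg (show 0 ≤ π / 6 by positivity) (m + 1)
  have hQ' := chooseExpSum_succ_le (show 0 < π / 6 by positivity) m
  set Q := chooseExpSum (π / 6) m
  set t := √(24 * n : ℝ)
  have h1 : 2 * (π / 6) + 2 / (π / 6) ≤ t := by
    refine le_trans ?_ ht
    have : 2 / (π / 6) ≤ 3.83 := by
      rw [div_le_iff₀ (by positivity)]
      linarith
    linarith
  have h2 : chooseExpSum (π / 6) (m + 1) ≤ t * Q := hQ'.trans (by gcongr)
  calc _ ≤ 6 / π * ((2 * (m + 1)) * (1 / (2 * t)) ^ (m + 1) * (t * Q)) := by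
        gcongr
        push_cast
        linarith
    _ = _ := by
        rw [pow_succ]
        field_simp

/-- The tail of the asymptotic series, cut after an even number of terms, is nonnegative and at
most its first term. -/
lemma tail_mem_Icc (N : ℕ) {n : ℕ} (hn : 1 ≤ n) {S : ℝ}
    (hS : HasSum (fun m : ℕ ↦ c m / (n : ℝ) ^ ((m : ℝ) / 2)) S) :
    S - ∑ m ∈ range (2 * N), c m / (n : ℝ) ^ ((m : ℝ) / 2) ∈ Set.Icc 0
      (6 / π * ((2 * N + 1) * (1 / (2 * √(24 * n))) ^ (2 * N) * chooseExpSum (π / 6) (2 * N))) := by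
  have hfun : (fun m : ℕ ↦ c m / (n : ℝ) ^ ((m : ℝ) / 2)) = fun m : ℕ ↦ (-1) ^ m *
      (6 / π * ((m + 1) * (1 / (2 * √(24 * n))) ^ m * chooseExpSum (π / 6) m)) :=
    funext fun m ↦ c_div_rpow m hn
  rw [hfun] at hS
  have hlim := hS.tendsto_sum_nat
  have h1 := (antitone_term hn).alternating_series_le_tendsto hlim N
  have h2 := (antitone_term hn).tendsto_le_alternating_series hlim N
  rw [sum_range_succ] at h2
  rw [Finset.sum_congr rfl fun m _ ↦ c_div_rpow m hn]
  constructor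
  · linarith
  · simp only [even_two, Even.mul_right, Even.neg_pow, one_pow, one_mul] at h2
    push_cast at h2 ⊢
    linarith

lemma first_omitted_term_le (N : ℕ) {n : ℕ} (hn : 1 ≤ n) :
    6 / π * ((2 * N + 1) * (1 / (2 * √(24 * n))) ^ (2 * N) * chooseExpSum (π / 6) (2 * N)) ≤
      6 * Real.sqrt 2 / π ^ ((3 : ℝ) / 2) * Real.sinh (π / 6) *
        (Real.sqrt (2 * N + 1) / Real.sqrt (24 * n) ^ (2 * N)) *
          Real.sqrt (1 + 1 / (4 * N + 1)) := by
  have hn' : (1 : ℝ) ≤ n := by exact_mod_cast hn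
  have hpi := Real.pi_pos
  have ht : 0 < √(24 * n : ℝ) := Real.sqrt_pos.2 (by positivity)
  set t := √(24 * n : ℝ)
  have hsinh : 0 ≤ Real.sinh (π / 6) := Real.sinh_nonneg_iff.2 (by positivity)
  have h1 := (chooseExpSum_two_mul_le (show 0 ≤ π / 6 by positivity) N).trans
    (mul_le_mul_of_nonneg_right (centralBinom_le_four_pow_mul_sqrt N) hsinh)
  have e1 : (1 / (2 * t)) ^ (2 * N) = 1 / (4 ^ N * t ^ (2 * N)) := by
    rw [div_pow, mul_pow, pow_mul 2 2 N]
    norm_num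
  have e2 : π ^ ((3 : ℝ) / 2) = π * √π := by
    rw [Real.sqrt_eq_rpow, show (3 : ℝ) / 2 = 1 + 1 / 2 by norm_num, Real.rpow_add hpi,
      Real.rpow_one]
  have e3 : (2 * N + 1) * √(4 / (π * (4 * N + 1))) * √π =
      √2 * √(2 * N + 1) * √(1 + 1 / (4 * N + 1) : ℝ) := by
    have h2 : (1 + 1 / (4 * N + 1) : ℝ) = 2 * (2 * N + 1) / (4 * N + 1) := by
      field_simp
      ring
    have h3 : √2 * √2 = (2 : ℝ) := Real.mul_self_sqrt (by norm_num)
    have h4 : √(2 * N + 1) * √(2 * N + 1) = (2 * N + 1 : ℝ) :=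
      Real.mul_self_sqrt (by positivity)
    rw [h2, Real.sqrt_div (by positivity), Real.sqrt_div (by positivity),
      Real.sqrt_mul (by positivity), Real.sqrt_mul (by positivity),
      show √(4 : ℝ) = 2 by rw [show (4 : ℝ) = 2 ^ 2 by norm_num, Real.sqrt_sq (by norm_num)]]
    have h5 : 0 < √π := Real.sqrt_pos.2 hpi
    field_simp
    linear_combination -√(2 * N + 1 : ℝ) ^ 2 * h3 - 2 * h4
  calc _ ≤ 6 / π * ((2 * N + 1) * (1 / (2 * t)) ^ (2 * N) *
        (4 ^ N * √(4 / (π * (4 * N + 1))) * Real.sinh (π / 6))) := by gcongr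
    _ = 6 / (π * √π) * Real.sinh (π / 6) *
        ((2 * N + 1) * √(4 / (π * (4 * N + 1))) * √π) / t ^ (2 * N) := by
      have h5 : 0 < √π := Real.sqrt_pos.2 hpi
      rw [e1]
      field_simp
    _ = _ := by
      rw [e3, e2]
      ring

theorem stmt11 (N n : ℕ) (hn : 1 ≤ n) :
    -Real.exp (-(π / 2 * Real.sqrt (2 * n / 3))) < R (2 * N) n ∧
      R (2 * N) n <
        6 * Real.sqrt 2 / π ^ ((3 : ℝ) / 2) * Real.sinh (π / 6) *
            (Real.sqrt (2 * N + 1) / Real.sqrt (24 * n) ^ (2 * N)) *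
              Real.sqrt (1 + 1 / (4 * N + 1)) +
          Real.exp (-(π / 2 * Real.sqrt (2 * n / 3))) := by
  have hn' : (1 : ℝ) ≤ n := by exact_mod_cast hn
  have hpi := Real.pi_pos
  obtain ⟨h1, h2⟩ := tail_mem_Icc N hn (hasSum_c_div_rpow hn)
  have h3 := first_omitted_term_le N hn
  have h4 := abs_p_sub_lt hn
  set M := 2 * √3 / (24 * n - 1) * (1 - 6 / (π * √(24 * n - 1))) *
    Real.exp (π * √(24 * n - 1) / 6)
  set A := 4 * √3 * n * Real.exp (-(π * √(2 * n / 3))) with hA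
  have hA0 : 0 < A := by positivity
  have e1 : √(24 * n : ℝ) = 6 * √(2 * n / 3) := by
    rw [show (24 * n : ℝ) = 6 ^ 2 * (2 * n / 3) by ring, Real.sqrt_mul (by norm_num),
      Real.sqrt_sq (by norm_num)]
  have e2 : A * (2 * √3 / (24 * n) * Real.exp (π * √(24 * n) / 12)) =
      Real.exp (-(π / 2 * √(2 * n / 3))) := by
    rw [hA, e1, show -(π / 2 * √(2 * n / 3 : ℝ)) =
      -(π * √(2 * n / 3)) + π * (6 * √(2 * n / 3)) / 12 by ring, Real.exp_add]
    have h33 : √3 * √3 = (3 : ℝ) := Real.mul_self_sqrt (by norm_num)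
    generalize Real.exp (-(π * √(2 * n / 3))) = E
    generalize Real.exp (π * (6 * √(2 * n / 3)) / 12) = F
    rw [show 4 * √3 * n * E * (2 * √3 / (24 * n) * F) =
      √3 * √3 * (4 * n * E * (2 / (24 * n) * F)) by ring, h33]
    field_simp
    ring
  have h5 : |A * (p n - M)| < Real.exp (-(π / 2 * √(2 * n / 3))) := by
    rw [abs_mul, abs_of_pos hA0, ← e2]
    exact mul_lt_mul_of_pos_left h4 hA0
  rw [abs_lt] at h5
  have h6 : R (2 * N) n = A * (p n - M) +
      (A * M - ∑ m ∈ range (2 * N), c m / (n : ℝ) ^ ((m : ℝ) / 2)) := by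
    rw [R]
    ring
  rw [h6]
  constructor <;> linarith
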